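/- arXiv:1107.2515 — 4 statements merged into one kernel-verified Lean document; each statement's English description precedes it below -/
import Mathlib

section
/- Let k ≥ 1 be an integer, λ > 0, and define ψ_k(t) = 1 − (λ√t)^k · E^k_{1/2, k/2+1}(−λ√t) for t ≥ 0. Then for every η > 0, ∫_0^∞ e^{−η t} ψ_k(t) dt = ((√η + λ)^k − λ^k) / (η (√η + λ)^k). -/
open Real MeasureTheory Set

/-- Mittag-Leffler function `E_{a,b}(z) = Σ z^r / Γ(a r + b)`. -/
noncomputable def mittagLeffler (a b z : ℝ) : ℝ :=
  ∑' r : ℕ, z ^ r / Real.Gamma (a * r + b)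

/-- Wright function `W_{a,b}(x) = Σ x^j / (j! Γ(a j + b))`. -/
noncomputable def wright (a b x : ℝ) : ℝ :=
  ∑' j : ℕ, x ^ j / ((Nat.factorial j : ℝ) * Real.Gamma (a * j + b))

/-- Generalized Mittag-Leffler function `E^γ_{a,b}(z) = Σ (γ)_j z^j / (j! Γ(a j + b))`. -/
noncomputable def gml (a b γ z : ℝ) : ℝ :=
  ∑' j : ℕ, (∏ i ∈ Finset.range j, (γ + i)) * z ^ j /
    ((Nat.factorial j : ℝ) * Real.Gamma (a * j + b))

/-- Caputo fractional derivative of order `ν`. -/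
noncomputable def caputo (ν : ℝ) (f : ℝ → ℝ) (t : ℝ) : ℝ :=
  (1 / Real.Gamma (1 - ν)) * ∫ s in (0:ℝ)..t, (t - s) ^ (-ν) * deriv f s
/-- Cumulative distribution function of a Gamma random variable with rate `lam`
and integer shape `k`. -/
noncomputable def gammaCdf (lam : ℝ) (k : ℕ) (y : ℝ) : ℝ :=
  (lam ^ k / Real.Gamma k) * ∫ z in (0:ℝ)..y, Real.exp (-lam * z) * z ^ (k - 1)

theorem hasSum_integral_pow_mul_exp_neg (m : ℕ) (y : ℝ) :
    HasSum (fun j : ℕ => (-1) ^ j * y ^ (m + 1 + j) / ((j.factorial : ℝ) * (m + 1 + j)))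
      (∫ z in (0:ℝ)..y, z ^ m * Real.exp (-z)) := by
  have key : HasSum (fun j : ℕ => ∫ z in (0:ℝ)..y, z ^ m * ((-z) ^ j / j.factorial))
      (∫ z in (0:ℝ)..y, z ^ m * Real.exp (-z)) := by
    refine intervalIntegral.hasSum_integral_of_dominated_convergence
      (fun j _ => |y| ^ m * (|y| ^ j / j.factorial)) ?_ ?_ ?_ ?_ ?_
    · intro j
      exact Continuous.aestronglyMeasurable (by fun_prop)
    · intro j
      refine Filter.Eventually.of_forall fun z hz => ?_
      have hzy : |z| ≤ |y| := by
        rcases mem_uIoc.1 hz with h | h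
        · exact abs_le_abs_of_nonneg h.1.le h.2
        · exact abs_le_abs_of_nonpos h.2 h.1.le
      rw [Real.norm_eq_abs, abs_mul, abs_div, abs_pow, abs_pow, abs_neg, Nat.abs_cast]
      gcongr
    · exact Filter.Eventually.of_forall fun z _ =>
        (Real.summable_pow_div_factorial |y|).mul_left _
    · exact intervalIntegrable_const
    · refine Filter.Eventually.of_forall fun z _ => ?_
      rw [Real.exp_eq_exp_ℝ]
      exact (NormedSpace.expSeries_div_hasSum_exp (-z)).mul_left _
  convert key using 2 with j
  have h : ∀ z : ℝ, z ^ m * ((-z) ^ j / j.factorial) = (-1) ^ j / j.factorial * z ^ (m + j) := by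
    intro z
    rw [neg_pow, pow_add]
    ring
  simp_rw [h]
  rw [intervalIntegral.integral_const_mul, integral_pow]
  have h1 : (m : ℝ) + 1 + j ≠ 0 := by positivity
  have h2 : (m : ℝ) + j + 1 ≠ 0 := by positivity
  have h3 : m + 1 + j = m + j + 1 := by ring
  push_cast
  rw [h3, zero_pow (Nat.succ_ne_zero _)]
  field_simp
  ring

theorem integral_pow_mul_exp_neg_nonneg (m : ℕ) {y : ℝ} (hy : 0 ≤ y) :
    0 ≤ ∫ z in (0:ℝ)..y, z ^ m * Real.exp (-z) :=
  intervalIntegral.integral_nonneg hy fun z hz => by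
    have := hz.1
    positivity

theorem integral_pow_mul_exp_neg_le_factorial (m : ℕ) {y : ℝ} (hy : 0 ≤ y) :
    ∫ z in (0:ℝ)..y, z ^ m * Real.exp (-z) ≤ m.factorial := by
  have hpos : (0:ℝ) < (m:ℝ) + 1 := by positivity
  have hint : IntegrableOn (fun z : ℝ => z ^ m * Real.exp (-z)) (Ioi 0) := by
    refine (Real.GammaIntegral_convergent hpos).congr_fun (fun z _ => ?_) measurableSet_Ioi
    simp [mul_comm]
  have hval : ∫ z in Ioi (0:ℝ), z ^ m * Real.exp (-z) = m.factorial := by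
    rw [← Real.Gamma_nat_eq_factorial, Real.Gamma_eq_integral hpos]
    refine setIntegral_congr_fun measurableSet_Ioi fun z _ => ?_
    simp [mul_comm]
  rw [← hval, intervalIntegral.integral_of_le hy]
  refine setIntegral_mono_set hint ?_ (Filter.Eventually.of_forall Ioc_subset_Ioi_self)
  refine (ae_restrict_mem measurableSet_Ioi).mono fun z (hz : 0 < z) => ?_
  simp only [Pi.zero_apply]
  positivity

theorem integrableOn_pow_mul_exp_mul_exp_neg_sq (n : ℕ) (c : ℝ) :
    IntegrableOn (fun u : ℝ => u ^ n * Real.exp (c * u) * Real.exp (-u ^ 2)) (Ioi 0) := by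
  have hn : (-1 : ℝ) < n := lt_of_lt_of_le (by norm_num) n.cast_nonneg
  have hdom := (integrableOn_rpow_mul_exp_neg_mul_sq (b := 1 / 2) (by norm_num) hn).const_mul
    (Real.exp (c ^ 2 / 2))
  refine hdom.mono' (Continuous.aestronglyMeasurable (by fun_prop)) ?_
  refine (ae_restrict_mem measurableSet_Ioi).mono fun u (hu : 0 < u) => ?_
  rw [Real.norm_of_nonneg (by positivity), Real.rpow_natCast, mul_assoc, ← Real.exp_add,
    mul_left_comm, ← Real.exp_add]
  refine mul_le_mul_of_nonneg_left (Real.exp_le_exp.2 ?_) (by positivity)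
  nlinarith [sq_nonneg (c - u)]

theorem integral_pow_mul_exp_neg_sq (n : ℕ) :
    ∫ u in Ioi (0:ℝ), u ^ n * Real.exp (-u ^ 2) =
      √π / 2 * n.factorial / (2 ^ n * Real.Gamma ((n:ℝ) / 2 + 1)) := by
  have hn : (-1 : ℝ) < n := lt_of_lt_of_le (by norm_num) n.cast_nonneg
  have h := integral_rpow_mul_exp_neg_rpow (p := 2) (q := n) (by norm_num) hn
  simp only [Real.rpow_natCast, Real.rpow_two] at h
  rw [h]
  have hd := Real.Gamma_mul_Gamma_add_half (((n:ℝ) + 1) / 2)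
  have hG : 0 < Real.Gamma ((n:ℝ) / 2 + 1) := Real.Gamma_pos_of_pos (by positivity)
  rw [show ((n:ℝ) + 1) / 2 + 1 / 2 = (n:ℝ) / 2 + 1 by ring,
    show 2 * (((n:ℝ) + 1) / 2) = n + 1 by ring, Real.Gamma_nat_eq_factorial,
    show (1:ℝ) - (n + 1) = -n by ring, Real.rpow_neg (by norm_num), Real.rpow_natCast] at hd
  rw [eq_div_iff (by positivity)]
  have : (2:ℝ) ^ n ≠ 0 := by positivity
  generalize Real.Gamma ((n:ℝ) / 2 + 1) = G at *
  generalize Real.Gamma (((n:ℝ) + 1) / 2) = H at *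
  field_simp at hd
  linear_combination (1 / 2 : ℝ) * hd

/-- The series of `x ^ k * gml (1/2) (k/2 + 1) k (-x)` with `k = m + 1`, term by term. -/
noncomputable def gmlTerm (m j : ℕ) (x : ℝ) : ℝ :=
  (-1) ^ j * ((j + m).choose m : ℝ) * x ^ (m + 1 + j) /
    Real.Gamma (((m + 1 + j : ℕ) : ℝ) / 2 + 1)

theorem pow_mul_gml_eq_tsum_gmlTerm (m : ℕ) (x : ℝ) :
    x ^ (m + 1) * gml (1 / 2) (((m + 1 : ℕ) : ℝ) / 2 + 1) (m + 1 : ℕ) (-x) =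
      ∑' j, gmlTerm m j x := by
  rw [gml, ← tsum_mul_left]
  refine tsum_congr fun j => ?_
  have hprod : ∏ i ∈ Finset.range j, (((m + 1 : ℕ) : ℝ) + i) =
      j.factorial * ((j + m).choose m : ℝ) := by
    have h : ∏ i ∈ Finset.range j, (((m + 1 : ℕ) : ℝ) + i) = ((m + 1).ascFactorial j : ℝ) := by
      rw [Nat.ascFactorial_eq_prod_range]
      push_cast
      rfl
    rw [h, Nat.ascFactorial_eq_factorial_mul_choose, add_comm m j, Nat.choose_symm_add]
    push_cast
    rfl
  have harg : (1 / 2 : ℝ) * j + (((m + 1 : ℕ) : ℝ) / 2 + 1) =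
      ((m + 1 + j : ℕ) : ℝ) / 2 + 1 := by
    push_cast
    ring
  rw [hprod, harg, gmlTerm, neg_pow x j, pow_add x (m + 1) j]
  have : (j.factorial : ℝ) ≠ 0 := by positivity
  rw [mul_assoc (j.factorial : ℝ), mul_div_mul_left _ _ this]
  ring

/-- Up to normalization, the Gamma distribution function averaged over a reflected Gaussian. -/
theorem hasSum_gmlTerm (m : ℕ) {x : ℝ} (hx : 0 ≤ x) :
    HasSum (fun j => gmlTerm m j x)
      (2 / √π / m.factorial * ∫ u in Ioi (0:ℝ),
        (∫ z in (0:ℝ)..(2 * x * u), z ^ m * Real.exp (-z)) * Real.exp (-u ^ 2)) := by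
  have key : HasSum (fun j : ℕ => ∫ u in Ioi (0:ℝ), (-1) ^ j * (2 * x * u) ^ (m + 1 + j) /
        ((j.factorial : ℝ) * (m + 1 + j)) * Real.exp (-u ^ 2))
      (∫ u in Ioi (0:ℝ),
        (∫ z in (0:ℝ)..(2 * x * u), z ^ m * Real.exp (-z)) * Real.exp (-u ^ 2)) := by
    have hsum : ∀ u : ℝ, HasSum (fun j : ℕ => (2 * x * u) ^ (m + 1) *
        ((2 * x * u) ^ j / j.factorial) * Real.exp (-u ^ 2))
        ((2 * x * u) ^ (m + 1) * Real.exp (2 * x * u) * Real.exp (-u ^ 2)) := by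
      intro u
      rw [Real.exp_eq_exp_ℝ]
      exact ((NormedSpace.expSeries_div_hasSum_exp (2 * x * u)).mul_left _).mul_right _
    refine hasSum_integral_of_dominated_convergence
      (fun j u => (2 * x * u) ^ (m + 1) * ((2 * x * u) ^ j / j.factorial) * Real.exp (-u ^ 2))
      ?_ ?_ ?_ ?_ ?_
    · intro j
      exact Continuous.aestronglyMeasurable (by fun_prop)
    · intro j
      refine (ae_restrict_mem measurableSet_Ioi).mono fun u (hu : 0 < u) => ?_
      have h0 : 0 ≤ 2 * x * u := by positivity
      rw [norm_mul, norm_div, norm_mul, norm_pow, norm_neg, norm_one, one_pow, one_mul,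
        Real.norm_of_nonneg (by positivity : 0 ≤ (2 * x * u) ^ (m + 1 + j)),
        Real.norm_of_nonneg (by positivity : (0:ℝ) ≤ (j.factorial : ℝ) * (m + 1 + j)),
        Real.norm_of_nonneg (Real.exp_pos _).le, pow_add, mul_div_assoc]
      gcongr
      refine le_mul_of_one_le_right (by positivity) ?_
      linarith [m.cast_nonneg (α := ℝ), j.cast_nonneg (α := ℝ)]
    · exact Filter.Eventually.of_forall fun u => (hsum u).summable
    · simp_rw [fun u => (hsum u).tsum_eq]
      convert! (integrableOn_pow_mul_exp_mul_exp_neg_sq (m + 1) (2 * x)).const_mul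
        ((2 * x) ^ (m + 1)) using 2 with u
      rw [mul_pow]
      ring
    · exact Filter.Eventually.of_forall fun u =>
        (hasSum_integral_pow_mul_exp_neg m (2 * x * u)).mul_right _
  refine HasSum.congr_fun (key.mul_left (2 / √π / m.factorial)) fun j => ?_
  have h : ∀ u : ℝ, (-1) ^ j * (2 * x * u) ^ (m + 1 + j) /
      ((j.factorial : ℝ) * (m + 1 + j)) * Real.exp (-u ^ 2) =
      (-1) ^ j * (2 * x) ^ (m + 1 + j) / ((j.factorial : ℝ) * (m + 1 + j)) *
        (u ^ (m + 1 + j) * Real.exp (-u ^ 2)) := by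
    intro u
    rw [mul_pow (2 * x) u]
    ring
  simp_rw [h]
  rw [integral_const_mul, integral_pow_mul_exp_neg_sq, gmlTerm]
  have hG : 0 < Real.Gamma (((m + 1 + j : ℕ) : ℝ) / 2 + 1) := Real.Gamma_pos_of_pos (by positivity)
  have hpi : 0 < √π := Real.sqrt_pos.2 Real.pi_pos
  have hfac : ((m + 1 + j).factorial : ℝ) =
      (m + 1 + j) * (((j + m).choose m : ℝ) * j.factorial * m.factorial) := by
    rw [show m + 1 + j = (j + m) + 1 by ring, Nat.factorial_succ,
      ← Nat.add_choose_mul_factorial_mul_factorial j m]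
    push_cast
    ring
  rw [hfac, mul_pow 2 x]
  have h1 : (m : ℝ) + 1 + j ≠ 0 := by positivity
  field_simp

theorem tsum_gmlTerm_nonneg (m : ℕ) {x : ℝ} (hx : 0 ≤ x) : 0 ≤ ∑' j, gmlTerm m j x := by
  rw [(hasSum_gmlTerm m hx).tsum_eq]
  refine mul_nonneg (by positivity) (setIntegral_nonneg measurableSet_Ioi fun u (hu : 0 < u) => ?_)
  exact mul_nonneg (integral_pow_mul_exp_neg_nonneg m (by positivity)) (Real.exp_pos _).le

theorem tsum_gmlTerm_le_one (m : ℕ) {x : ℝ} (hx : 0 ≤ x) : ∑' j, gmlTerm m j x ≤ 1 := by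
  rw [(hasSum_gmlTerm m hx).tsum_eq]
  have hpi : 0 < √π := Real.sqrt_pos.2 Real.pi_pos
  have hle : ∫ u in Ioi (0:ℝ),
      (∫ z in (0:ℝ)..(2 * x * u), z ^ m * Real.exp (-z)) * Real.exp (-u ^ 2) ≤
      ∫ u in Ioi (0:ℝ), m.factorial * (u ^ 0 * Real.exp (-u ^ 2)) := by
    refine integral_mono_of_nonneg ?_ ?_ ?_
    · refine (ae_restrict_mem measurableSet_Ioi).mono fun u (hu : 0 < u) => ?_
      exact mul_nonneg (integral_pow_mul_exp_neg_nonneg m (by positivity)) (Real.exp_pos _).le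
    · refine Integrable.const_mul ?_ _
      simpa [IntegrableOn] using integrableOn_pow_mul_exp_mul_exp_neg_sq 0 0
    · refine (ae_restrict_mem measurableSet_Ioi).mono fun u (hu : 0 < u) => ?_
      simp only [pow_zero, one_mul]
      gcongr
      exact integral_pow_mul_exp_neg_le_factorial m (by positivity)
  rw [integral_const_mul, integral_pow_mul_exp_neg_sq] at hle
  simp only [Nat.factorial_zero, pow_zero, Nat.cast_zero, zero_div, zero_add, Real.Gamma_one,
    Nat.cast_one, mul_one, div_one] at hle
  calc _ ≤ 2 / √π / m.factorial * (m.factorial * (√π / 2)) := by gcongr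
    _ = 1 := by field_simp

theorem measurable_tsum_gmlTerm (m : ℕ) (lam : ℝ) (hlam : 0 < lam) :
    Measurable fun t : ℝ => ∑' j, gmlTerm m j (lam * √t) := by
  refine measurable_of_tendsto_metrizable
    (f := fun (n : ℕ) (t : ℝ) => ∑ j ∈ Finset.range n, gmlTerm m j (lam * √t)) ?_ ?_
  · intro n
    unfold gmlTerm
    fun_prop
  · refine tendsto_pi_nhds.2 fun t => ?_
    exact (hasSum_gmlTerm m (by positivity)).summable.hasSum.tendsto_sum_nat

theorem integrableOn_exp_mul_gmlTerm (m j : ℕ) (lam : ℝ) {s : ℝ} (hs : 0 < s) :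
    IntegrableOn (fun t : ℝ => Real.exp (-s ^ 2 * t) * gmlTerm m j (lam * √t)) (Ioi 0) ∧
    ∫ t in Ioi (0:ℝ), Real.exp (-s ^ 2 * t) * gmlTerm m j (lam * √t) =
      (-1) ^ j * ((j + m).choose m : ℝ) * lam ^ (m + 1 + j) / s ^ (m + 1 + j + 2) := by
  set n := m + 1 + j with hn
  set G := Real.Gamma ((n : ℝ) / 2 + 1) with hGdef
  have hG : 0 < G := Real.Gamma_pos_of_pos (by positivity)
  have hs2 : 0 < s ^ 2 := by positivity
  have heq : EqOn (fun t : ℝ => (-1) ^ j * ((j + m).choose m : ℝ) * lam ^ n / G *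
        (t ^ ((n : ℝ) / 2) * Real.exp (-s ^ 2 * t)))
      (fun t : ℝ => Real.exp (-s ^ 2 * t) * gmlTerm m j (lam * √t)) (Ioi 0) := by
    intro t ht
    have ht : 0 < t := ht
    have hr : (√t) ^ n = t ^ ((n : ℝ) / 2) := by
      rw [Real.sqrt_eq_rpow, ← Real.rpow_natCast, ← Real.rpow_mul ht.le]
      congr 1
      ring
    simp only [gmlTerm]
    rw [← hn, mul_pow, hr]
    ring
  have hexp : (-1 : ℝ) < (n : ℝ) / 2 := 
    lt_of_lt_of_le neg_one_lt_zero (by positivity)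
  constructor
  · refine IntegrableOn.congr_fun (Integrable.const_mul ?_ _) heq measurableSet_Ioi
    simpa [IntegrableOn] using integrableOn_rpow_mul_exp_neg_mul_rpow (p := 1) hexp one_pos hs2
  · rw [← setIntegral_congr_fun measurableSet_Ioi heq, integral_const_mul]
    have h := Real.integral_rpow_mul_exp_neg_mul_Ioi (a := (n : ℝ) / 2 + 1) (r := s ^ 2)
      (by positivity) hs2
    have hp : (1 / s ^ 2) ^ ((n : ℝ) / 2 + 1) = 1 / s ^ (n + 2) := by
      rw [Real.div_rpow zero_le_one hs2.le, Real.one_rpow, ← Real.rpow_natCast s 2,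
        ← Real.rpow_mul hs.le, ← Real.rpow_natCast s (n + 2)]
      congr 2
      push_cast
      ring
    rw [hp] at h
    simp only [add_sub_cancel_right] at h
    simp only [neg_mul]
    rw [h, ← hGdef]
    field_simp

theorem integral_exp_mul_tsum_gmlTerm_of_lt (m : ℕ) {lam s : ℝ} (hlam : 0 < lam) (hs : lam < s) :
    ∫ t in Ioi (0:ℝ), Real.exp (-s ^ 2 * t) * ∑' j, gmlTerm m j (lam * √t) =
      lam ^ (m + 1) / (s ^ 2 * (s + lam) ^ (m + 1)) := by
  have hs0 : 0 < s := hlam.trans hs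
  have hr : |lam / s| < 1 := by
    rw [abs_of_pos (by positivity), div_lt_one hs0]
    exact hs
  have habs : ∀ (j : ℕ) (t : ℝ), ‖Real.exp (-s ^ 2 * t) * gmlTerm m j (lam * √t)‖ =
      (-1) ^ j * (Real.exp (-s ^ 2 * t) * gmlTerm m j (lam * √t)) := by
    intro j t
    have hG : 0 < Real.Gamma (((m + 1 + j : ℕ) : ℝ) / 2 + 1) :=
      Real.Gamma_pos_of_pos (by positivity)
    rw [Real.norm_eq_abs, gmlTerm, abs_mul, abs_div, abs_mul, abs_mul, abs_neg_one_pow,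
      abs_of_pos hG, abs_of_pos (Real.exp_pos _), Nat.abs_cast,
      abs_of_nonneg (by positivity : 0 ≤ (lam * √t) ^ (m + 1 + j))]
    have h1 : ((-1 : ℝ) ^ j) * (-1) ^ j = 1 := by rw [← mul_pow]; norm_num
    linear_combination (-(Real.exp (-s ^ 2 * t) * ((j + m).choose m *
      (lam * √t) ^ (m + 1 + j) / Real.Gamma (((m + 1 + j : ℕ) : ℝ) / 2 + 1)))) * h1
  have hsum := hasSum_integral_of_summable_integral_norm
    (μ := volume.restrict (Ioi (0:ℝ)))
    (F := fun (j : ℕ) (t : ℝ) => Real.exp (-s ^ 2 * t) * gmlTerm m j (lam * √t))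
    (fun j => (integrableOn_exp_mul_gmlTerm m j lam hs0).1) (by
      simp_rw [habs, integral_const_mul, fun j => (integrableOn_exp_mul_gmlTerm m j lam hs0).2]
      have h := (summable_choose_mul_geometric_of_norm_lt_one m (r := lam / s) hr).mul_left
        (lam ^ (m + 1) / s ^ (m + 3))
      refine h.congr fun j => ?_
      have h1 : ((-1 : ℝ) ^ j) * (-1) ^ j = 1 := by rw [← mul_pow]; norm_num
      rw [← mul_div_assoc, ← mul_assoc ((-1) ^ j), ← mul_assoc ((-1) ^ j), h1, div_pow]
      field_simp
      ring)
  simp_rw [fun j => (integrableOn_exp_mul_gmlTerm m j lam hs0).2, tsum_mul_left] at hsum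
  rw [← hsum.tsum_eq]
  have hgeo := (hasSum_choose_mul_geometric_of_norm_lt_one m (r := -(lam / s))
    (by rwa [norm_neg])).mul_left (lam ^ (m + 1) / s ^ (m + 3))
  have hfin : lam ^ (m + 1) / s ^ (m + 3) * (1 / (1 - -(lam / s)) ^ (m + 1)) =
      lam ^ (m + 1) / (s ^ 2 * (s + lam) ^ (m + 1)) := by
    rw [show 1 - -(lam / s) = (s + lam) / s by field_simp; ring, div_pow]
    field_simp
    ring
  rw [← hfin, ← hgeo.tsum_eq]
  refine tsum_congr fun j => ?_
  rw [neg_pow (lam / s), div_pow]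
  field_simp
  ring

theorem integrableOn_exp_mul_tsum_gmlTerm (m : ℕ) {lam η : ℝ} (hlam : 0 < lam) (hη : 0 < η) :
    IntegrableOn (fun t => Real.exp (-η * t) * ∑' j, gmlTerm m j (lam * √t)) (Ioi 0) := by
  refine (exp_neg_integrableOn_Ioi 0 hη).mono' ?_ (Filter.Eventually.of_forall fun t => ?_)
  · have := measurable_tsum_gmlTerm m lam hlam
    exact Measurable.aestronglyMeasurable (by fun_prop)
  · have hx : 0 ≤ lam * √t := by positivity
    rw [norm_mul, Real.norm_of_nonneg (Real.exp_pos _).le,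
      Real.norm_of_nonneg (tsum_gmlTerm_nonneg m hx)]
    exact mul_le_of_le_one_right (Real.exp_pos _).le (tsum_gmlTerm_le_one m hx)

/-- A Laplace transform of a nonnegative function is analytic where it converges. -/
theorem analyticOnNhd_laplace_of_nonneg {g : ℝ → ℝ} (hg : Measurable g) (hg0 : ∀ t, 0 ≤ g t)
    (hint : ∀ η : ℝ, 0 < η → IntegrableOn (fun t => Real.exp (-η * t) * g t) (Ioi 0)) :
    AnalyticOnNhd ℝ (fun η => ∫ t in Ioi (0:ℝ), Real.exp (-η * t) * g t) (Ioi 0) := by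
  set μ := (volume.restrict (Ioi (0:ℝ))).withDensity fun t => ENNReal.ofReal (g t) with hμ
  have hmgf : (fun η => ∫ t in Ioi (0:ℝ), Real.exp (-η * t) * g t) =
      ProbabilityTheory.mgf (fun t => -t) μ := by
    funext η
    rw [ProbabilityTheory.mgf, hμ, integral_withDensity_eq_integral_toReal_smul
      (by fun_prop) (Filter.Eventually.of_forall fun _ => ENNReal.ofReal_lt_top)]
    refine integral_congr_ae (Filter.Eventually.of_forall fun t => ?_)
    simp [ENNReal.toReal_ofReal (hg0 t), mul_comm]
  have hsub : Ioi (0:ℝ) ⊆ ProbabilityTheory.integrableExpSet (fun t => -t) μ := by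
    intro η hη
    rw [ProbabilityTheory.integrableExpSet, mem_ofPred_eq, hμ, integrable_withDensity_iff
      (by fun_prop) (Filter.Eventually.of_forall fun _ => ENNReal.ofReal_lt_top)]
    refine (hint η hη).congr (Filter.Eventually.of_forall fun t => ?_)
    simp [ENNReal.toReal_ofReal (hg0 t)]
  rw [hmgf]
  exact ProbabilityTheory.analyticOnNhd_mgf.mono (interior_maximal hsub isOpen_Ioi)

theorem integral_exp_mul_tsum_gmlTerm (m : ℕ) {lam s : ℝ} (hlam : 0 < lam) (hs : 0 < s) :
    ∫ t in Ioi (0:ℝ), Real.exp (-s ^ 2 * t) * ∑' j, gmlTerm m j (lam * √t) =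
      lam ^ (m + 1) / (s ^ 2 * (s + lam) ^ (m + 1)) := by
  have hL := analyticOnNhd_laplace_of_nonneg (measurable_tsum_gmlTerm m lam hlam)
    (fun t => tsum_gmlTerm_nonneg m (by positivity))
    (fun η hη => integrableOn_exp_mul_tsum_gmlTerm m hlam hη)
  have hf : AnalyticOnNhd ℝ (fun s : ℝ => ∫ t in Ioi (0:ℝ),
      Real.exp (-s ^ 2 * t) * ∑' j, gmlTerm m j (lam * √t)) (Ioi 0) := by
    intro s hs
    have hs : 0 < s := hs
    exact (hL (s ^ 2) (mem_Ioi.2 (by positivity))).comp_of_eq (f := fun s : ℝ => s ^ 2)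
      (by fun_prop) rfl
  have hg : AnalyticOnNhd ℝ
      (fun s : ℝ => lam ^ (m + 1) / (s ^ 2 * (s + lam) ^ (m + 1))) (Ioi 0) := by
    intro s hs
    have hs : 0 < s := hs
    exact AnalyticAt.div (by fun_prop) (by fun_prop) (by positivity)
  refine hf.eqOn_of_preconnected_of_eventuallyEq hg isPreconnected_Ioi
    (z₀ := lam + 1) (mem_Ioi.2 (by positivity)) ?_ (mem_Ioi.2 hs)
  filter_upwards [Ioi_mem_nhds (lt_add_one lam)] with s hs
  exact integral_exp_mul_tsum_gmlTerm_of_lt m hlam hs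

theorem brownian_gamma_crossing_laplace (k : ℕ) (hk : 1 ≤ k) (lam : ℝ) (hlam : 0 < lam) :
    ∀ η > (0:ℝ),
      (∫ t in Set.Ioi (0:ℝ), Real.exp (-η * t) *
          (1 - (lam * Real.sqrt t) ^ k *
            gml (1/2) ((k:ℝ)/2 + 1) k (-(lam * Real.sqrt t)))) =
        ((Real.sqrt η + lam) ^ k - lam ^ k) / (η * (Real.sqrt η + lam) ^ k) := by
  intro η hη
  obtain ⟨m, rfl⟩ : ∃ m, k = m + 1 := ⟨k - 1, by omega⟩
  simp_rw [pow_mul_gml_eq_tsum_gmlTerm, mul_sub, mul_one]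
  have hs : 0 < √η := Real.sqrt_pos.2 hη
  have hsq : √η ^ 2 = η := Real.sq_sqrt hη.le
  have h := integral_exp_mul_tsum_gmlTerm m hlam hs
  rw [hsq] at h
  have h1 : ∫ t in Ioi (0:ℝ), Real.exp (-η * t) = 1 / η := by
    rw [integral_exp_mul_Ioi (neg_lt_zero.2 hη)]
    simp
  rw [integral_sub (exp_neg_integrableOn_Ioi 0 hη) (integrableOn_exp_mul_tsum_gmlTerm m hlam hη),
    h, h1]
  field_simp
end

section
/- Let λ > 0 and, for each integer j ≥ 0, define ψ_j(t) = 1 − (λ√t)^j · E^j_{1/2, j/2+1}(−λ√t) for t > 0 (so that ψ_0 ≡ 0). Then for every integer k ≥ 1 and every t > 0, the Caputo derivative of order 1/2 satisfies (D^{1/2} ψ_k)(t) = −λ (ψ_k(t) − ψ_{k−1}(t)); equivalently, (D^{1/2} ψ_k)(t) = −λ^k t^{(k−1)/2} E^k_{1/2,(k+1)/2}(−λ√t). -/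
open Real MeasureTheory Set

theorem gml_natCast_eq_tsum_multichoose (a b z : ℝ) (k : ℕ) :
    gml a b k z = ∑' r : ℕ, (k.multichoose r : ℝ) * z ^ r / Real.Gamma (a * r + b) := by
  unfold gml
  refine tsum_congr fun r => ?_
  have h : (∏ i ∈ Finset.range r, ((k : ℝ) + i)) = (r.factorial : ℝ) * k.multichoose r := by
    have h1 := Nat.ascFactorial_eq_prod_range k r
    have h2 := Nat.ascFactorial_eq_factorial_mul_choose' k r
    rw [← Nat.multichoose_eq, h1] at h2
    exact_mod_cast h2
  rw [h, mul_assoc, mul_div_mul_left _ _ (by positivity)]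

theorem rpow_mul_exp_neg_le_Gamma {A s : ℝ} (hA : 0 < A) (hs : 1 ≤ s) :
    A ^ (s - 1) * Real.exp (-A) ≤ Real.Gamma s := by
  have hs0 : 0 < s := by linarith
  have hint := Real.GammaIntegral_convergent hs0
  have hsub : Ioi A ⊆ Ioi 0 := Ioi_subset_Ioi hA.le
  rw [Real.Gamma_eq_integral hs0]
  calc A ^ (s - 1) * Real.exp (-A) = ∫ x in Ioi A, Real.exp (-x) * A ^ (s - 1) := by
        rw [integral_mul_const, integral_exp_neg_Ioi, mul_comm]
    _ ≤ ∫ x in Ioi A, Real.exp (-x) * x ^ (s - 1) := by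
        refine setIntegral_mono_on ?_ (hint.mono_set hsub) measurableSet_Ioi fun x hx => ?_
        · exact (integrableOn_exp_neg_Ioi A).mul_const _
        · have : A < x := hx
          gcongr
    _ ≤ ∫ x in Ioi 0, Real.exp (-x) * x ^ (s - 1) := by
        refine setIntegral_mono_set hint ?_ hsub.eventuallyLE
        filter_upwards [ae_restrict_mem measurableSet_Ioi] with x hx
        have : 0 < x := hx
        positivity

theorem summable_multichoose_mul_pow_div_Gamma (k : ℕ) {b : ℝ} (hb : 0 < b) (X : ℝ) :
    Summable fun r : ℕ => (k.multichoose r : ℝ) * X ^ r / Real.Gamma (1 / 2 * r + b) := by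
  set B : ℝ := 4 * |X| + 1 with hB
  have hB0 : 0 < B := by positivity
  have hq : 2 * |X| / B ≤ 1 / 2 := by
    rw [div_le_iff₀ hB0]
    linarith
  refine Summable.of_norm_bounded_eventually_nat
    (g := fun r => 2 ^ k * Real.exp (B ^ 2) * (B ^ 2) ^ (1 - b) * (1 / 2 : ℝ) ^ r)
    (summable_geometric_two.mul_left _) ?_
  filter_upwards [Filter.eventually_ge_atTop 2] with r hr
  have hr' : (2 : ℝ) ≤ r := by exact_mod_cast hr
  have hG := rpow_mul_exp_neg_le_Gamma (A := B ^ 2) (s := 1 / 2 * r + b) (by positivity)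
    (by linarith)
  have hpow : (B ^ 2) ^ (1 / 2 * (r : ℝ) + b - 1) = B ^ r * ((B ^ 2) ^ (1 - b))⁻¹ := by
    rw [add_sub_assoc, Real.rpow_add (by positivity), ← Real.rpow_neg (by positivity), neg_sub,
      Real.rpow_mul (by positivity), ← Real.sqrt_eq_rpow, Real.sqrt_sq hB0.le, Real.rpow_natCast]
  rw [hpow, Real.exp_neg] at hG
  have hmc : (k.multichoose r : ℝ) ≤ 2 ^ k * 2 ^ r := by
    rw [← pow_add, Nat.multichoose_eq]
    have : (k + r - 1).choose r ≤ 2 ^ (k + r) :=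
      (Nat.choose_le_two_pow _ _).trans (Nat.pow_le_pow_right (by norm_num) (by omega))
    exact_mod_cast this
  have hGpos : 0 < Real.Gamma (1 / 2 * r + b) := Real.Gamma_pos_of_pos (by positivity)
  rw [norm_div, norm_mul, norm_pow, Real.norm_natCast, Real.norm_of_nonneg hGpos.le,
    Real.norm_eq_abs]
  calc (k.multichoose r : ℝ) * |X| ^ r / Real.Gamma (1 / 2 * r + b)
      ≤ (2 ^ k * 2 ^ r) * |X| ^ r / (B ^ r * ((B ^ 2) ^ (1 - b))⁻¹ * (Real.exp (B ^ 2))⁻¹) := by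
        gcongr
    _ = 2 ^ k * Real.exp (B ^ 2) * (B ^ 2) ^ (1 - b) * (2 * |X| / B) ^ r := by
        rw [div_pow, mul_pow]
        field_simp
    _ ≤ _ := by gcongr

theorem integral_rpow_mul_rpow_sub {t u v : ℝ} (ht : 0 < t) (hu : 0 < u) (hv : 0 < v) :
    ∫ s in (0:ℝ)..t, (t - s) ^ (v - 1) * s ^ (u - 1) =
      t ^ (u + v - 1) * (Real.Gamma u * Real.Gamma v / Real.Gamma (u + v)) := by
  have h := Complex.betaIntegral_scaled u v ht
  rw [Complex.betaIntegral_eq_Gamma_mul_div _ _ (by simpa) (by simpa), ← Complex.ofReal_add,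
    Complex.Gamma_ofReal, Complex.Gamma_ofReal, Complex.Gamma_ofReal] at h
  have h' : ((∫ s in (0:ℝ)..t, (t - s) ^ (v - 1) * s ^ (u - 1) : ℝ) : ℂ) =
      ((t ^ (u + v - 1) * (Real.Gamma u * Real.Gamma v / Real.Gamma (u + v)) : ℝ) : ℂ) := by
    rw [← intervalIntegral.integral_ofReal]
    push_cast [Complex.ofReal_cpow ht.le]
    push_cast at h
    rw [← h]
    refine intervalIntegral.integral_congr fun s hs => ?_
    rw [uIcc_of_le ht.le] at hs
    rw [Complex.ofReal_cpow hs.1, Complex.ofReal_cpow (sub_nonneg.2 hs.2), mul_comm]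
    push_cast
    rfl
  exact_mod_cast h'

theorem integrableOn_rpow_mul_rpow_sub {t u v : ℝ} (ht : 0 < t) (hu : 0 < u) (hv : 0 < v) :
    IntegrableOn (fun s => (t - s) ^ (v - 1) * s ^ (u - 1)) (Ioc 0 t) := by
  refine Integrable.of_integral_ne_zero ?_
  rw [← intervalIntegral.integral_of_le ht.le, integral_rpow_mul_rpow_sub ht hu hv]
  have h1 := Real.Gamma_pos_of_pos hu
  have h2 := Real.Gamma_pos_of_pos hv
  have h3 := Real.Gamma_pos_of_pos (add_pos hu hv)
  positivity

theorem rpow_half_mul_natCast_add {y : ℝ} (hy : 0 < y) (r : ℕ) (b : ℝ) :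
    y ^ (1 / 2 * (r : ℝ) + b) = Real.sqrt y ^ r * y ^ b := by
  rw [Real.rpow_add hy, Real.rpow_mul hy.le, ← Real.sqrt_eq_rpow, Real.rpow_natCast]

theorem hasDerivAt_tsum_rpow_div_Gamma {a : ℕ → ℝ} {b : ℝ} (hb : 0 < b)
    (ha : ∀ c > 0, ∀ X : ℝ, Summable fun r : ℕ => a r * X ^ r / Real.Gamma (1 / 2 * r + c))
    {s : ℝ} (hs : 0 < s) :
    HasDerivAt (fun y => ∑' r : ℕ, a r * y ^ (1 / 2 * (r : ℝ) + b) /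
        Real.Gamma (1 / 2 * r + (b + 1)))
      (∑' r : ℕ, a r * s ^ (1 / 2 * (r : ℝ) + b - 1) / Real.Gamma (1 / 2 * r + b)) s := by
  have hmem : s ∈ Ioo (s / 2) (2 * s) := ⟨by linarith, by linarith⟩
  refine hasDerivAt_tsum_of_isPreconnected (t := Ioo (s / 2) (2 * s)) (y₀ := s)
    (g := fun (r : ℕ) y => a r * y ^ (1 / 2 * (r : ℝ) + b) / Real.Gamma (1 / 2 * r + (b + 1)))
    (g' := fun (r : ℕ) y => a r * y ^ (1 / 2 * (r : ℝ) + b - 1) / Real.Gamma (1 / 2 * r + b))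
    (u := fun r : ℕ => ‖a r * Real.sqrt (2 * s) ^ r / Real.Gamma (1 / 2 * r + b)‖ *
      ((2 * s) ^ b * (s / 2)⁻¹))
    ((ha b hb _).norm.mul_right _) isOpen_Ioo isPreconnected_Ioo ?_ ?_ hmem ?_ hmem
  · intro r y hy
    have hy0 : 0 < y := by linarith [hy.1]
    have hp : 0 < 1 / 2 * (r : ℝ) + b := by positivity
    have hG := Real.Gamma_pos_of_pos hp
    have h := ((Real.hasDerivAt_rpow_const (p := 1 / 2 * (r : ℝ) + b)
      (Or.inl hy0.ne')).const_mul (a r)).div_const (Real.Gamma (1 / 2 * r + (b + 1)))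
    refine h.congr_deriv ?_
    rw [← add_assoc, Real.Gamma_add_one hp.ne']
    field_simp
  · intro r y hy
    have hy0 : 0 < y := by linarith [hy.1]
    have hp : 0 < 1 / 2 * (r : ℝ) + b := by positivity
    have hG := Real.Gamma_pos_of_pos hp
    rw [Real.rpow_sub_one hy0.ne', rpow_half_mul_natCast_add hy0, norm_div, norm_mul,
      Real.norm_of_nonneg (show 0 ≤ Real.sqrt y ^ r * y ^ b / y by positivity), norm_div,
      norm_mul, Real.norm_of_nonneg hG.le,
      Real.norm_of_nonneg (show 0 ≤ Real.sqrt (2 * s) ^ r by positivity)]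
    calc ‖a r‖ * (Real.sqrt y ^ r * y ^ b / y) / Real.Gamma (1 / 2 * r + b)
        ≤ ‖a r‖ * (Real.sqrt (2 * s) ^ r * (2 * s) ^ b / (s / 2)) /
          Real.Gamma (1 / 2 * r + b) := by
          gcongr
          exacts [hy.2.le, hy.2.le, hy.1.le]
      _ = _ := by ring
  · refine ((ha (b + 1) (by linarith) (Real.sqrt s)).mul_right (s ^ b)).congr fun r => ?_
    rw [rpow_half_mul_natCast_add hs]
    ring

theorem integral_tsum_rpow_div_Gamma {a : ℕ → ℝ} {b : ℝ} (hb : 0 < b)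
    (ha : ∀ c > 0, ∀ X : ℝ, Summable fun r : ℕ => a r * X ^ r / Real.Gamma (1 / 2 * r + c))
    {t : ℝ} (ht : 0 < t) :
    ∫ s in (0:ℝ)..t, (t - s) ^ (-(1 / 2) : ℝ) *
        ∑' r : ℕ, a r * s ^ (1 / 2 * (r : ℝ) + b - 1) / Real.Gamma (1 / 2 * r + b) =
      Real.Gamma (1 / 2) * ∑' r : ℕ, a r * t ^ (1 / 2 * (r : ℝ) + (b - 1 / 2)) /
        Real.Gamma (1 / 2 * r + (b + 1 / 2)) := by
  have hv : (-(1 / 2) : ℝ) = 1 / 2 - 1 := by norm_num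
  have hp (r : ℕ) : 0 < 1 / 2 * (r : ℝ) + b := by positivity
  have key (c : ℝ) (r : ℕ) : ∫ s in Ioc 0 t, c / Real.Gamma (1 / 2 * r + b) *
      ((t - s) ^ (1 / 2 - 1 : ℝ) * s ^ (1 / 2 * (r : ℝ) + b - 1)) =
      Real.Gamma (1 / 2) * (c * t ^ (1 / 2 * (r : ℝ) + (b - 1 / 2)) /
        Real.Gamma (1 / 2 * r + (b + 1 / 2))) := by
    have hG := Real.Gamma_pos_of_pos (hp r)
    rw [integral_const_mul, ← intervalIntegral.integral_of_le ht.le,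
      integral_rpow_mul_rpow_sub ht (hp r) (by norm_num),
      show 1 / 2 * (r : ℝ) + b + 1 / 2 - 1 = 1 / 2 * (r : ℝ) + (b - 1 / 2) by ring,
      show 1 / 2 * (r : ℝ) + b + 1 / 2 = 1 / 2 * (r : ℝ) + (b + 1 / 2) by ring]
    field_simp
  rw [intervalIntegral.integral_of_le ht.le, hv, ← tsum_mul_left]
  simp_rw [← key, ← tsum_mul_left]
  rw [integral_tsum_of_summable_integral_norm]
  · refine integral_congr_ae (ae_of_all _ fun s => tsum_congr fun r => ?_)
    ring
  · exact fun r => (integrableOn_rpow_mul_rpow_sub (v := 1 / 2) ht (hp r) (by norm_num)).const_mul _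
  · have hnorm (r : ℕ) : ∫ s in Ioc 0 t, ‖a r / Real.Gamma (1 / 2 * r + b) *
        ((t - s) ^ (1 / 2 - 1 : ℝ) * s ^ (1 / 2 * (r : ℝ) + b - 1))‖ =
        ‖a r * Real.sqrt t ^ r / Real.Gamma (1 / 2 * r + (b + 1 / 2))‖ *
          (Real.Gamma (1 / 2) * t ^ (b - 1 / 2)) := by
      have hG := Real.Gamma_pos_of_pos (hp r)
      have hG' : 0 < Real.Gamma (1 / 2 * (r : ℝ) + (b + 1 / 2)) :=
        Real.Gamma_pos_of_pos (by positivity)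
      rw [norm_div, norm_mul, Real.norm_of_nonneg hG'.le,
        Real.norm_of_nonneg (show 0 ≤ Real.sqrt t ^ r by positivity)]
      have := key ‖a r‖ r
      rw [rpow_half_mul_natCast_add ht] at this
      trans Real.Gamma (1 / 2) * (‖a r‖ * (Real.sqrt t ^ r * t ^ (b - 1 / 2)) /
        Real.Gamma (1 / 2 * r + (b + 1 / 2)))
      · rw [← this]
        refine setIntegral_congr_fun measurableSet_Ioc fun s hs => ?_
        have h1 : 0 ≤ t - s := sub_nonneg.2 hs.2
        have h2 : 0 ≤ s := hs.1.le
        rw [norm_mul, norm_div, Real.norm_of_nonneg hG.le, Real.norm_of_nonneg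
          (show 0 ≤ (t - s) ^ (1 / 2 - 1 : ℝ) * s ^ (1 / 2 * (r : ℝ) + b - 1) by positivity)]
      · ring
    simp_rw [hnorm]
    exact (ha (b + 1 / 2) (by linarith) _).norm.mul_right _

theorem caputo_half_one_sub_tsum {a : ℕ → ℝ} {b : ℝ} (hb : 0 < b)
    (ha : ∀ c > 0, ∀ X : ℝ, Summable fun r : ℕ => a r * X ^ r / Real.Gamma (1 / 2 * r + c))
    {f : ℝ → ℝ} (hf : ∀ y > 0, f y = 1 - ∑' r : ℕ, a r * y ^ (1 / 2 * (r : ℝ) + b) /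
        Real.Gamma (1 / 2 * r + (b + 1))) {t : ℝ} (ht : 0 < t) :
    caputo (1 / 2) f t = -∑' r : ℕ, a r * t ^ (1 / 2 * (r : ℝ) + (b - 1 / 2)) /
        Real.Gamma (1 / 2 * r + (b + 1 / 2)) := by
  have hderiv (s : ℝ) (hs : 0 < s) : deriv f s =
      -∑' r : ℕ, a r * s ^ (1 / 2 * (r : ℝ) + b - 1) / Real.Gamma (1 / 2 * r + b) := by
    have h := ((hasDerivAt_tsum_rpow_div_Gamma hb ha hs).const_sub 1).congr_of_eventuallyEq
      (f₁ := f) (by filter_upwards [lt_mem_nhds hs] with y hy using hf y hy)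
    exact h.deriv
  have hint : ∫ s in (0:ℝ)..t, (t - s) ^ (-(1 / 2) : ℝ) * deriv f s =
      -∫ s in (0:ℝ)..t, (t - s) ^ (-(1 / 2) : ℝ) *
        ∑' r : ℕ, a r * s ^ (1 / 2 * (r : ℝ) + b - 1) / Real.Gamma (1 / 2 * r + b) := by
    rw [← intervalIntegral.integral_neg, intervalIntegral.integral_of_le ht.le,
      intervalIntegral.integral_of_le ht.le]
    refine setIntegral_congr_fun measurableSet_Ioc fun s hs => ?_
    rw [hderiv s hs.1]
    ring
  have hG : 0 < Real.Gamma (1 / 2) := Real.Gamma_pos_of_pos (by norm_num)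
  rw [caputo, hint, integral_tsum_rpow_div_Gamma hb ha ht,
    show (1 : ℝ) - 1 / 2 = 1 / 2 by norm_num]
  field_simp

/-- The Pascal-type recurrence `E^{k+1}_{1/2,b}(z) = E^k_{1/2,b}(z) + z E^{k+1}_{1/2,b+1/2}(z)`
in the upper index. -/
theorem gml_half_succ (k : ℕ) {b : ℝ} (hb : 0 < b) (z : ℝ) :
    gml (1 / 2) b ((k + 1 : ℕ) : ℝ) z =
      gml (1 / 2) b k z + z * gml (1 / 2) (b + 1 / 2) ((k + 1 : ℕ) : ℝ) z := by
  simp only [gml_natCast_eq_tsum_multichoose]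
  have h1 := summable_multichoose_mul_pow_div_Gamma k hb z
  have h2 := summable_multichoose_mul_pow_div_Gamma (k + 1) hb z
  rw [h1.tsum_eq_zero_add, h2.tsum_eq_zero_add, ← tsum_mul_left, add_assoc,
    ← ((summable_nat_add_iff 1).2 h1).tsum_add
      ((summable_multichoose_mul_pow_div_Gamma (k + 1) (b := b + 1 / 2) (by linarith) z).mul_left
        z)]
  congr 1
  · simp
  · refine tsum_congr fun r => ?_
    rw [Nat.multichoose_succ_succ,
      show 1 / 2 * ((r + 1 : ℕ) : ℝ) + b = 1 / 2 * (r : ℝ) + (b + 1 / 2) by push_cast; ring]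
    push_cast
    ring

theorem brownian_gamma_crossing_caputo (lam : ℝ) (hlam : 0 < lam) :
    let ψ : ℕ → ℝ → ℝ := fun j t =>
      1 - (lam * Real.sqrt t) ^ j * gml (1/2) ((j:ℝ)/2 + 1) j (-(lam * Real.sqrt t))
    ∀ k : ℕ, 1 ≤ k → ∀ t > (0:ℝ),
      caputo (1/2) (ψ k) t = -lam * (ψ k t - ψ (k - 1) t) ∧
      caputo (1/2) (ψ k) t =
        -lam ^ k * t ^ (((k:ℝ) - 1) / 2) *
          gml (1/2) (((k:ℝ) + 1) / 2) k (-(lam * Real.sqrt t)) := by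
  intro ψ k hk t ht
  have hk0 : (0 : ℝ) < k := by exact_mod_cast hk
  have hsqrt (y : ℝ) (hy : 0 < y) (j : ℕ) : Real.sqrt y ^ j = y ^ ((j : ℝ) / 2) := by
    rw [Real.sqrt_eq_rpow, ← Real.rpow_natCast, ← Real.rpow_mul hy.le]
    ring_nf
  have h2 : caputo (1/2) (ψ k) t =
      -lam ^ k * t ^ (((k:ℝ) - 1) / 2) *
        gml (1/2) (((k:ℝ) + 1) / 2) k (-(lam * Real.sqrt t)) := by
    rw [caputo_half_one_sub_tsum (b := (k : ℝ) / 2)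
      (a := fun r => lam ^ k * ((k.multichoose r : ℝ) * (-lam) ^ r)) (by positivity) ?_ ?_ ht]
    · rw [gml_natCast_eq_tsum_multichoose, neg_mul, neg_mul, neg_inj, ← tsum_mul_left]
      refine tsum_congr fun r => ?_
      rw [rpow_half_mul_natCast_add ht, show (k : ℝ) / 2 - 1 / 2 = ((k : ℝ) - 1) / 2 by ring,
        show (k : ℝ) / 2 + 1 / 2 = ((k : ℝ) + 1) / 2 by ring, ← neg_mul, mul_pow]
      ring
    · intro c hc X
      refine ((summable_multichoose_mul_pow_div_Gamma k hc (-lam * X)).mul_left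
        (lam ^ k)).congr fun r => ?_
      rw [mul_pow]
      ring
    · intro y hy
      simp only [ψ]
      rw [gml_natCast_eq_tsum_multichoose, ← tsum_mul_left]
      congr 1
      refine tsum_congr fun r => ?_
      rw [rpow_half_mul_natCast_add hy, ← hsqrt y hy, mul_pow, ← neg_mul, mul_pow]
      ring
  refine ⟨?_, h2⟩
  rw [h2]
  obtain ⟨m, rfl⟩ : ∃ m, k = m + 1 := ⟨k - 1, by omega⟩
  have hrec := gml_half_succ m (b := (m : ℝ) / 2 + 1) (by positivity) (-(lam * Real.sqrt t))
  simp only [ψ, Nat.add_sub_cancel]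
  rw [show (((m + 1 : ℕ) : ℝ) - 1) / 2 = (m : ℝ) / 2 by push_cast; ring, ← hsqrt t ht,
    show (((m + 1 : ℕ) : ℝ) + 1) / 2 = (m : ℝ) / 2 + 1 by push_cast; ring, hrec,
    show ((m + 1 : ℕ) : ℝ) / 2 + 1 = (m : ℝ) / 2 + 1 + 1 / 2 by push_cast; ring]
  ring
end

section
/- Let 0 < ν₁ < ν₂ < 1, let n₁, n₂ > 0 with n₁ + n₂ = 1, and let λ > 0. Define ψ(t) = 1 − (λ t^{ν₂}/n₂) · Σ_{r=0}^∞ (−n₁ t^{ν₂−ν₁}/n₂)^r · E^{r+1}_{ν₂, ν₂ + (ν₂−ν₁)r + 1}(−λ t^{ν₂}/n₂) for t > 0, with ψ(0) = 1. Then ψ solves the double-order fractional relaxation equation: for every t > 0, n₁ (D^{ν₁} ψ)(t) + n₂ (D^{ν₂} ψ)(t) = −λ ψ(t), and equivalently there exists η₀ ≥ 0 such that for all η > η₀, ∫_0^∞ e^{−η t} ψ(t) dt = (n₁ η^{ν₁} + n₂ η^{ν₂}) / (η (λ + n₁ η^{ν₁} + n₂ η^{ν₂})). -/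
open Real MeasureTheory Set

/-- The coefficient of `x ^ r * y ^ j` in `1 / (1 - x - y)`, times `x ^ r * y ^ j`. -/
noncomputable def geomCoeff (x y : ℝ) (q : ℕ × ℕ) : ℝ :=
  ((q.2 + q.1).choose q.1 : ℝ) * x ^ q.1 * y ^ q.2

/-- The double fractional power series
`∑ C(r+j,r) x^r y^j t^(d r + e j + c) / Γ(d r + e j + c + 1)`. -/
noncomputable def fracSeries (x y d e c t : ℝ) : ℝ :=
  ∑' q : ℕ × ℕ, geomCoeff x y q *
    (t ^ (d * q.1 + e * q.2 + c) / Real.Gamma (d * q.1 + e * q.2 + c + 1))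

lemma abs_geomCoeff (x y : ℝ) (q : ℕ × ℕ) : |geomCoeff x y q| = geomCoeff |x| |y| q := by
  simp [geomCoeff, abs_mul, abs_pow]

lemma geomCoeff_nonneg {x y : ℝ} (hx : 0 ≤ x) (hy : 0 ≤ y) (q : ℕ × ℕ) :
    0 ≤ geomCoeff x y q := by
  unfold geomCoeff; positivity

lemma hasSum_geomCoeff_fiber (x : ℝ) {y : ℝ} (hy : ‖y‖ < 1) (r : ℕ) :
    HasSum (fun j => geomCoeff x y (r, j)) ((x / (1 - y)) ^ r * (1 / (1 - y))) := by
  convert! (hasSum_choose_mul_geometric_of_norm_lt_one r hy).mul_left (x ^ r) using 1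
  · ext j
    simp only [geomCoeff]
    ring
  · rw [div_pow, pow_succ, div_mul_div_comm, mul_one, mul_one_div]

lemma summable_geomCoeff_of_nonneg {x y : ℝ} (hx : 0 ≤ x) (hy : 0 ≤ y) (h : x + y < 1) :
    Summable (geomCoeff x y) := by
  have hy1 : ‖y‖ < 1 := by rw [Real.norm_of_nonneg hy]; linarith
  have key := hasSum_geomCoeff_fiber x hy1
  rw [summable_prod_of_nonneg (fun q => geomCoeff_nonneg hx hy q)]
  refine ⟨fun r => (key r).summable, ?_⟩
  simp_rw [fun r => (key r).tsum_eq]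
  refine Summable.mul_right _ (summable_geometric_of_lt_one (div_nonneg hx (by linarith)) ?_)
  rw [div_lt_one (by linarith)]; linarith

lemma hasSum_geomCoeff {x y : ℝ} (h : |x| + |y| < 1) :
    HasSum (geomCoeff x y) (1 / (1 - x - y)) := by
  have hy1 : ‖y‖ < 1 := by rw [Real.norm_eq_abs]; linarith [abs_nonneg x]
  have hy2 : y < 1 := by linarith [le_abs_self y, abs_nonneg x]
  have hs : Summable (geomCoeff x y) := by
    refine Summable.of_norm_bounded
      (summable_geomCoeff_of_nonneg (abs_nonneg x) (abs_nonneg y) h) fun q => ?_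
    rw [Real.norm_eq_abs, abs_geomCoeff]
  have key := hasSum_geomCoeff_fiber x hy1
  have h1 := hs.hasSum.prod_fiberwise key
  have h2 : |x / (1 - y)| < 1 := by
    rw [abs_div, abs_of_pos (by linarith : 0 < 1 - y), div_lt_one (by linarith)]
    linarith [le_abs_self y]
  have h3 := (hasSum_geometric_of_abs_lt_one h2).mul_right (1 / (1 - y))
  have h4 := h1.unique h3
  have h5 : (1 - x / (1 - y))⁻¹ * (1 / (1 - y)) = 1 / (1 - x - y) := by
    have h6 : 1 - y ≠ 0 := by linarith
    have h7 : 1 - x - y ≠ 0 := by linarith [le_abs_self y, le_abs_self x]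
    have h8 : 1 - x / (1 - y) = (1 - x - y) / (1 - y) := by field_simp; ring
    rw [h8]; field_simp
  rw [← h5, ← h4]
  exact hs.hasSum

lemma geomCoeff_mul_rpow (x y d e c : ℝ) {s : ℝ} (hs : 0 < s) (q : ℕ × ℕ) :
    geomCoeff x y q * s ^ (d * q.1 + e * q.2 + c) =
      s ^ c * geomCoeff (x * s ^ d) (y * s ^ e) q := by
  simp only [geomCoeff]
  rw [Real.rpow_add hs, Real.rpow_add hs, Real.rpow_mul hs.le, Real.rpow_mul hs.le,
    Real.rpow_natCast, Real.rpow_natCast, mul_pow, mul_pow]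
  ring

lemma hasSum_geomCoeff_mul_rpow (x y d e c : ℝ) {s : ℝ} (hs : 0 < s)
    (h : |x| * s ^ d + |y| * s ^ e < 1) :
    HasSum (fun q : ℕ × ℕ => geomCoeff x y q * s ^ (d * q.1 + e * q.2 + c))
      (s ^ c / (1 - x * s ^ d - y * s ^ e)) := by
  simp_rw [fun q => geomCoeff_mul_rpow x y d e c hs q]
  rw [div_eq_mul_one_div]
  refine (hasSum_geomCoeff ?_).mul_left _
  rwa [abs_mul, abs_mul, abs_of_pos (Real.rpow_pos_of_pos hs _),
    abs_of_pos (Real.rpow_pos_of_pos hs _)]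

lemma exists_forall_gt_mul_rpow_add_lt_one (x y : ℝ) {d e : ℝ} (hd : 0 < d) (he : 0 < e) :
    ∃ η₀ : ℝ, 0 ≤ η₀ ∧ ∀ η > η₀, |x| * (1 / η) ^ d + |y| * (1 / η) ^ e < 1 := by
  have h : Filter.Tendsto (fun η : ℝ => |x| * η ^ (-d) + |y| * η ^ (-e)) Filter.atTop
      (nhds (|x| * 0 + |y| * 0)) :=
    ((tendsto_rpow_neg_atTop hd).const_mul _).add ((tendsto_rpow_neg_atTop he).const_mul _)
  have h1 := h.eventually_lt_const (show |x| * 0 + |y| * 0 < (1 : ℝ) by norm_num)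
  obtain ⟨η₁, h2⟩ := Filter.eventually_atTop.1 h1
  refine ⟨max η₁ 0, le_max_right _ _, fun η hη => ?_⟩
  have h3 : 0 < η := lt_of_le_of_lt (le_max_right _ _) hη
  have h4 := h2 η ((le_max_left _ _).trans hη.le)
  simpa [Real.inv_rpow h3.le, Real.rpow_neg h3.le] using h4

lemma rpow_mul_exp_neg_le_Gamma_s18 {p K : ℝ} (hp : 0 ≤ p) (hK : 0 < K) :
    K ^ p * Real.exp (-K) ≤ Real.Gamma (p + 1) := by
  have hint := Real.GammaIntegral_convergent (show 0 < p + 1 by linarith)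
  rw [Real.Gamma_eq_integral (by linarith), ← integral_exp_neg_Ioi, ← integral_const_mul]
  simp only [add_sub_cancel_right] at hint ⊢
  have hsub : Ioi K ⊆ Ioi (0 : ℝ) := Ioi_subset_Ioi hK.le
  calc ∫ x in Ioi K, K ^ p * Real.exp (-x) ≤ ∫ x in Ioi K, Real.exp (-x) * x ^ p := by
        refine setIntegral_mono_on ((integrableOn_exp_neg_Ioi K).const_mul _)
          (hint.mono_set hsub) measurableSet_Ioi fun x hx => ?_
        rw [mul_comm]
        gcongr
        exact le_of_lt hx
    _ ≤ ∫ x in Ioi 0, Real.exp (-x) * x ^ p := by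
        refine setIntegral_mono_set hint ?_ hsub.eventuallyLE
        filter_upwards [ae_restrict_mem measurableSet_Ioi] with x hx
        have : (0 : ℝ) < x := hx
        simp only [Pi.zero_apply]
        positivity

lemma rpow_div_Gamma_le {p t η : ℝ} (hp : 0 ≤ p) (ht : 0 < t) (hη : 0 < η) :
    t ^ p / Real.Gamma (p + 1) ≤ Real.exp (η * t) * (1 / η) ^ p := by
  rw [div_le_iff₀ (Real.Gamma_pos_of_pos (by linarith))]
  calc t ^ p = Real.exp (η * t) * (1 / η) ^ p * ((η * t) ^ p * Real.exp (-(η * t))) := by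
        rw [Real.mul_rpow hη.le ht.le, Real.div_rpow zero_le_one hη.le, Real.one_rpow, Real.exp_neg]
        have := (Real.rpow_pos_of_pos hη p).ne'
        field_simp
    _ ≤ _ := by
        gcongr
        exact rpow_mul_exp_neg_le_Gamma_s18 hp (by positivity)

lemma exponent_nonneg {d e c : ℝ} (hd : 0 < d) (he : 0 < e) (hc : 0 ≤ c) (q : ℕ × ℕ) :
    0 ≤ d * q.1 + e * q.2 + c := by positivity

lemma summable_fracSeries_abs (x y : ℝ) {d e c t : ℝ} (hd : 0 < d) (he : 0 < e) (hc : 0 ≤ c)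
    (ht : 0 < t) :
    Summable fun q : ℕ × ℕ => |geomCoeff x y q| *
      (t ^ (d * q.1 + e * q.2 + c) / Real.Gamma (d * q.1 + e * q.2 + c + 1)) := by
  obtain ⟨η₀, h0, h⟩ := exists_forall_gt_mul_rpow_add_lt_one x y hd he
  have hη : 0 < η₀ + 1 := by linarith
  have h1 := (hasSum_geomCoeff_mul_rpow |x| |y| d e c (one_div_pos.2 hη)
    (by simpa using h (η₀ + 1) (by linarith))).summable.mul_left (Real.exp ((η₀ + 1) * t))
  refine Summable.of_nonneg_of_le (fun q => ?_) (fun q => ?_) h1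
  · have := Real.Gamma_pos_of_pos (show 0 < d * q.1 + e * q.2 + c + 1 by positivity)
    positivity
  · rw [abs_geomCoeff]
    have h2 := rpow_div_Gamma_le (exponent_nonneg hd he hc q) ht hη
    have h3 := geomCoeff_nonneg (abs_nonneg x) (abs_nonneg y) q
    calc _ ≤ _ := mul_le_mul_of_nonneg_left h2 h3
      _ = _ := by ring

lemma summable_fracSeries (x y : ℝ) {d e c t : ℝ} (hd : 0 < d) (he : 0 < e) (hc : 0 ≤ c)
    (ht : 0 < t) :
    Summable fun q : ℕ × ℕ => geomCoeff x y q *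
      (t ^ (d * q.1 + e * q.2 + c) / Real.Gamma (d * q.1 + e * q.2 + c + 1)) := by
  refine Summable.of_norm_bounded (summable_fracSeries_abs x y hd he hc ht) fun q => ?_
  have := Real.Gamma_pos_of_pos (show 0 < d * q.1 + e * q.2 + c + 1 by positivity)
  rw [norm_mul, Real.norm_eq_abs, Real.norm_of_nonneg (by positivity)]

lemma hasDerivAt_fracSeries (x y : ℝ) {d e c t : ℝ} (hd : 0 < d) (he : 0 < e) (hc : 0 < c)
    (ht : 0 < t) :
    HasDerivAt (fracSeries x y d e c) (fracSeries x y d e (c - 1) t) t := by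
  have hpos : ∀ q : ℕ × ℕ, 0 < d * q.1 + e * q.2 + c := fun q => by positivity
  have hΓ : ∀ q : ℕ × ℕ, Real.Gamma (d * q.1 + e * q.2 + c + 1) =
      (d * q.1 + e * q.2 + c) * Real.Gamma (d * q.1 + e * q.2 + (c - 1) + 1) := fun q => by
    rw [Real.Gamma_add_one (hpos q).ne']; ring_nf
  have hu := (summable_fracSeries_abs x y hd he hc.le
    (show 0 < Real.exp 1 * (2 * t) by positivity)).mul_left (2 / t)
  refine hasDerivAt_tsum_of_isPreconnected
    (g := fun (q : ℕ × ℕ) s => geomCoeff x y q *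
      (s ^ (d * q.1 + e * q.2 + c) / Real.Gamma (d * q.1 + e * q.2 + c + 1)))
    (g' := fun (q : ℕ × ℕ) s => geomCoeff x y q *
      (s ^ (d * q.1 + e * q.2 + (c - 1)) / Real.Gamma (d * q.1 + e * q.2 + (c - 1) + 1)))
    (t := Ioo (t / 2) (2 * t)) (y₀ := t) hu isOpen_Ioo isPreconnected_Ioo ?_ ?_ ?_ ?_ ?_
  · rintro q s ⟨hs, -⟩
    have hs0 : 0 < s := by linarith
    have hg := Real.Gamma_pos_of_pos
      (show 0 < d * q.1 + e * q.2 + (c - 1) + 1 by linarith [hpos q])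
    refine HasDerivAt.const_mul _ ?_
    convert! (Real.hasDerivAt_rpow_const (p := d * q.1 + e * q.2 + c) (Or.inl hs0.ne')).div_const
      (Real.Gamma (d * q.1 + e * q.2 + c + 1)) using 1
    rw [hΓ, mul_div_mul_left _ _ (hpos q).ne']
    ring_nf
  · rintro q s ⟨hs, hs'⟩
    have hs0 : 0 < s := by linarith
    have hg := Real.Gamma_pos_of_pos
      (show 0 < d * q.1 + e * q.2 + (c - 1) + 1 by linarith [hpos q])
    rw [norm_mul, Real.norm_eq_abs, Real.norm_of_nonneg (by positivity), ← mul_assoc,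
      mul_comm (2 / t), mul_assoc]
    refine mul_le_mul_of_nonneg_left ?_ (abs_nonneg _)
    have hp := hpos q
    rw [hΓ]
    set p := d * q.1 + e * q.2 + c with hpdef
    set G := Real.Gamma (d * q.1 + e * q.2 + (c - 1) + 1)
    have h1 : d * q.1 + e * q.2 + (c - 1) = p - 1 := by rw [hpdef]; ring
    rw [h1, Real.rpow_sub_one hs0.ne', Real.mul_rpow (by positivity) (by positivity),
      ← Real.exp_mul, one_mul]
    have h2 : p ≤ Real.exp p := by linarith [Real.add_one_le_exp p]
    have h3 : s ^ p ≤ (2 * t) ^ p := Real.rpow_le_rpow hs0.le hs'.le hp.le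
    have h4 : 1 / s ≤ 2 / t := by
      rw [div_le_div_iff₀ hs0 ht]; linarith
    have h5 : 1 ≤ Real.exp p / p := by rwa [one_le_div hp]
    calc s ^ p / s / G = (1 / s) * (1 * s ^ p / G) := by ring
      _ ≤ (2 / t) * ((Real.exp p / p) * (2 * t) ^ p / G) := by gcongr
      _ = _ := by field_simp
  · constructor <;> linarith
  · exact summable_fracSeries x y hd he hc.le ht
  · constructor <;> linarith

lemma integral_sub_rpow_mul_rpow {u v t : ℝ} (hu : 0 < u) (hv : 0 < v) (ht : 0 < t) :
    ∫ s in (0 : ℝ)..t, (t - s) ^ (v - 1) * s ^ (u - 1) =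
      t ^ (u + v - 1) * (Real.Gamma u * Real.Gamma v / Real.Gamma (u + v)) := by
  have h := Complex.betaIntegral_scaled (u : ℂ) (v : ℂ) ht
  rw [Complex.betaIntegral_eq_Gamma_mul_div _ _ (by simpa) (by simpa)] at h
  have h2 : ∫ s in (0 : ℝ)..t, (s : ℂ) ^ ((u : ℂ) - 1) * ((t : ℂ) - s) ^ ((v : ℂ) - 1) =
      ∫ s in (0 : ℝ)..t, (((t - s) ^ (v - 1) * s ^ (u - 1) : ℝ) : ℂ) := by
    refine intervalIntegral.integral_congr fun s hs => ?_
    rw [uIcc_of_le ht.le] at hs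
    push_cast [Complex.ofReal_cpow hs.1, Complex.ofReal_cpow (sub_nonneg.2 hs.2)]
    ring
  rw [h2, intervalIntegral.integral_ofReal, ← Complex.ofReal_add, Complex.Gamma_ofReal,
    Complex.Gamma_ofReal, Complex.Gamma_ofReal] at h
  have h3 : (t : ℂ) ^ (((u + v : ℝ) : ℂ) - 1) = ((t ^ (u + v - 1) : ℝ) : ℂ) := by
    rw [Complex.ofReal_cpow ht.le]; push_cast; rfl
  rw [h3] at h
  exact_mod_cast h

lemma integral_sub_rpow_mul_fracSeries (x y : ℝ) {d e c ν t : ℝ} (hd : 0 < d) (he : 0 < e)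
    (hν0 : 0 < ν) (hν : ν < 1) (hc : ν ≤ c) (ht : 0 < t) :
    ∫ s in (0 : ℝ)..t, (t - s) ^ (-ν) * fracSeries x y d e (c - 1) s =
      Real.Gamma (1 - ν) * fracSeries x y d e (c - ν) t := by
  have hc0 : 0 < c := hν0.trans_le hc
  have hΓν := Real.Gamma_pos_of_pos (show 0 < 1 - ν by linarith)
  have hΓ : ∀ q : ℕ × ℕ, 0 < Real.Gamma (d * q.1 + e * q.2 + (c - 1) + 1) := fun q =>
    Real.Gamma_pos_of_pos (by
      have := exponent_nonneg hd he hc0.le q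
      have : 0 ≤ d * q.1 + e * q.2 := by positivity
      linarith)
  have hΓ' : ∀ q : ℕ × ℕ, 0 < Real.Gamma (d * q.1 + e * q.2 + (c - ν) + 1) := fun q =>
    Real.Gamma_pos_of_pos (by
      have := exponent_nonneg hd he (sub_nonneg.2 hc) q
      linarith)
  have hbeta : ∀ q : ℕ × ℕ, ∫ s in Ioc 0 t, (t - s) ^ (-ν) *
      (s ^ (d * q.1 + e * q.2 + (c - 1)) / Real.Gamma (d * q.1 + e * q.2 + (c - 1) + 1)) =
      Real.Gamma (1 - ν) * (t ^ (d * q.1 + e * q.2 + (c - ν)) /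
        Real.Gamma (d * q.1 + e * q.2 + (c - ν) + 1)) := by
    intro q
    have hp : 0 < d * q.1 + e * q.2 + c := by positivity
    have h := integral_sub_rpow_mul_rpow hp (show 0 < 1 - ν by linarith) ht
    rw [intervalIntegral.integral_of_le ht.le] at h
    have e1 : d * q.1 + e * q.2 + c - 1 = d * q.1 + e * q.2 + (c - 1) := by ring
    have e2 : 1 - ν - 1 = -ν := by ring
    have e3 : d * q.1 + e * q.2 + c + (1 - ν) - 1 = d * q.1 + e * q.2 + (c - ν) := by ring
    have e4 : d * q.1 + e * q.2 + c + (1 - ν) = d * q.1 + e * q.2 + (c - ν) + 1 := by ring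
    have e5 : d * q.1 + e * q.2 + c = d * q.1 + e * q.2 + (c - 1) + 1 := by ring
    rw [e1, e2, e3, e4, e5] at h
    simp_rw [← mul_div_assoc]
    rw [integral_div, h]
    have := (hΓ q).ne'
    have := (hΓ' q).ne'
    field_simp
  have hbint : ∀ q : ℕ × ℕ, Integrable (fun s => (t - s) ^ (-ν) *
      (s ^ (d * q.1 + e * q.2 + (c - 1)) / Real.Gamma (d * q.1 + e * q.2 + (c - 1) + 1)))
      (volume.restrict (Ioc 0 t)) := by
    intro q
    apply Integrable.of_integral_ne_zero
    rw [hbeta q]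
    have := hΓ' q
    positivity
  have hmain := hasSum_integral_of_summable_integral_norm (μ := volume.restrict (Ioc 0 t))
    (F := fun (q : ℕ × ℕ) s => geomCoeff x y q * ((t - s) ^ (-ν) *
      (s ^ (d * q.1 + e * q.2 + (c - 1)) / Real.Gamma (d * q.1 + e * q.2 + (c - 1) + 1))))
    (fun q => (hbint q).const_mul _) ?_
  · rw [intervalIntegral.integral_of_le ht.le]
    have h1 : (fun s => (t - s) ^ (-ν) * fracSeries x y d e (c - 1) s) = fun s =>
        ∑' q : ℕ × ℕ, geomCoeff x y q * ((t - s) ^ (-ν) *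
      (s ^ (d * q.1 + e * q.2 + (c - 1)) / Real.Gamma (d * q.1 + e * q.2 + (c - 1) + 1))) := by
      ext s
      rw [fracSeries, ← tsum_mul_left]
      exact tsum_congr fun q => by ring
    rw [h1, ← hmain.tsum_eq, fracSeries, ← tsum_mul_left]
    refine tsum_congr fun q => ?_
    rw [integral_const_mul, hbeta]
    ring
  · have h2 : ∀ q : ℕ × ℕ, ∫ s in Ioc 0 t, ‖geomCoeff x y q * ((t - s) ^ (-ν) *
      (s ^ (d * q.1 + e * q.2 + (c - 1)) / Real.Gamma (d * q.1 + e * q.2 + (c - 1) + 1)))‖ =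
      Real.Gamma (1 - ν) * (|geomCoeff x y q| * (t ^ (d * q.1 + e * q.2 + (c - ν)) /
        Real.Gamma (d * q.1 + e * q.2 + (c - ν) + 1))) := by
      intro q
      rw [mul_left_comm, ← hbeta, ← integral_const_mul]
      refine setIntegral_congr_fun measurableSet_Ioc fun s hs => ?_
      have := hΓ q
      have h3 : 0 < s := hs.1
      have h4 : 0 ≤ t - s := sub_nonneg.2 hs.2
      rw [norm_mul, Real.norm_eq_abs, Real.norm_of_nonneg (by positivity)]
    simp_rw [h2]
    exact (summable_fracSeries_abs x y hd he (sub_nonneg.2 hc) ht).mul_left _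

lemma fracSeries_zero (x y : ℝ) {d e t : ℝ} (hd : 0 < d) (he : 0 < e) (ht : 0 < t) :
    fracSeries x y d e 0 t =
      1 + x * fracSeries x y d e d t + y * fracSeries x y d e e t := by
  have hinj1 : Function.Injective fun q : ℕ × ℕ => (q.1 + 1, q.2) := by
    rintro ⟨a, b⟩ ⟨a', b'⟩ h; simpa using h
  have hinj2 : Function.Injective fun q : ℕ × ℕ => (q.1, q.2 + 1) := by
    rintro ⟨a, b⟩ ⟨a', b'⟩ h; simpa using h
  have h1 := ((summable_fracSeries x y hd he hd.le ht).hasSum).mul_left x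
  have h2 := ((summable_fracSeries x y hd he he.le ht).hasSum).mul_left y
  let T : ℕ × ℕ → ℝ := fun q =>
    t ^ (d * q.1 + e * q.2 + 0) / Real.Gamma (d * q.1 + e * q.2 + 0 + 1)
  let F1 : ℕ × ℕ → ℝ := fun q =>
    if q.1 = 0 then 0 else x * geomCoeff x y (q.1 - 1, q.2) * T q
  let F2 : ℕ × ℕ → ℝ := fun q =>
    if q.2 = 0 then 0 else y * geomCoeff x y (q.1, q.2 - 1) * T q
  have k1 : HasSum F1 (x * fracSeries x y d e d t) := by
    refine (hinj1.hasSum_iff ?_).1 ?_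
    · rintro ⟨a, b⟩ h
      rcases a with _ | a
      · simp [F1]
      · exact absurd ⟨(a, b), rfl⟩ h
    · convert! h1 using 1
      ext q
      have h3 : d * ((q.1 + 1 : ℕ) : ℝ) + e * q.2 + 0 = d * q.1 + e * q.2 + d := by
        push_cast; ring
      simp only [F1, T, Function.comp, h3]
      simp [mul_assoc]
  have k2 : HasSum F2 (y * fracSeries x y d e e t) := by
    refine (hinj2.hasSum_iff ?_).1 ?_
    · rintro ⟨a, b⟩ h
      rcases b with _ | b
      · simp [F2]
      · exact absurd ⟨(a, b), rfl⟩ h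
    · convert! h2 using 1
      ext q
      have h3 : d * (q.1 : ℝ) + e * ((q.2 + 1 : ℕ) : ℝ) + 0 = d * q.1 + e * q.2 + e := by
        push_cast; ring
      simp only [F2, T, Function.comp, h3]
      simp [mul_assoc]
  have k0 : HasSum (fun q : ℕ × ℕ => if q = (0, 0) then (1 : ℝ) else 0) 1 :=
    hasSum_ite_eq _ _
  rw [← ((k0.add k1).add k2).tsum_eq, fracSeries]
  refine tsum_congr fun q => ?_
  change geomCoeff x y q * T q = _
  obtain ⟨a, b⟩ := q
  rcases a with _ | a <;> rcases b with _ | b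
  · simp [F1, F2, T, geomCoeff]
  · simp [F1, F2, geomCoeff, pow_succ, mul_comm]
  · simp [F1, F2, geomCoeff, pow_succ, mul_comm]
  · have h4 : (b + 1 + (a + 1)).choose (a + 1) =
        (b + 1 + a).choose a + (b + (a + 1)).choose (a + 1) := by
      have : b + (a + 1) = b + 1 + a := by ring
      rw [this, ← add_assoc, Nat.choose_succ_succ]
    simp only [F1, F2, geomCoeff, h4, pow_succ]
    simp
    ring

lemma integral_exp_mul_fracSeries (x y : ℝ) {d e c η : ℝ} (hd : 0 < d) (he : 0 < e)
    (hc : 0 ≤ c) (hη : 0 < η) (h : |x| * (1 / η) ^ d + |y| * (1 / η) ^ e < 1) :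
    ∫ t in Ioi (0 : ℝ), Real.exp (-η * t) * fracSeries x y d e c t =
      (1 / η) ^ (c + 1) / (1 - x * (1 / η) ^ d - y * (1 / η) ^ e) := by
  have hη' : 0 < 1 / η := one_div_pos.2 hη
  have hΓ : ∀ q : ℕ × ℕ, 0 < Real.Gamma (d * q.1 + e * q.2 + c + 1) := fun q =>
    Real.Gamma_pos_of_pos (by positivity)
  have hlap : ∀ q : ℕ × ℕ, ∫ t in Ioi 0, Real.exp (-η * t) *
      (t ^ (d * q.1 + e * q.2 + c) / Real.Gamma (d * q.1 + e * q.2 + c + 1)) =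
      (1 / η) ^ (d * q.1 + e * q.2 + (c + 1)) := by
    intro q
    have h1 := Real.integral_rpow_mul_exp_neg_mul_Ioi
      (show 0 < d * q.1 + e * q.2 + c + 1 by positivity) hη
    simp only [add_sub_cancel_right] at h1
    simp_rw [← mul_div_assoc, mul_comm (Real.exp _), neg_mul]
    rw [integral_div, h1, mul_div_cancel_right₀ _ (hΓ q).ne', add_assoc]
  have hint : ∀ q : ℕ × ℕ, Integrable (fun t => Real.exp (-η * t) *
      (t ^ (d * q.1 + e * q.2 + c) / Real.Gamma (d * q.1 + e * q.2 + c + 1)))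
      (volume.restrict (Ioi 0)) := by
    intro q
    apply Integrable.of_integral_ne_zero
    rw [hlap q]
    positivity
  have hmain := hasSum_integral_of_summable_integral_norm (μ := volume.restrict (Ioi 0))
    (F := fun (q : ℕ × ℕ) t => geomCoeff x y q * (Real.exp (-η * t) *
      (t ^ (d * q.1 + e * q.2 + c) / Real.Gamma (d * q.1 + e * q.2 + c + 1))))
    (fun q => (hint q).const_mul _) ?_
  · have h1 : (fun t => Real.exp (-η * t) * fracSeries x y d e c t) = fun t =>
        ∑' q : ℕ × ℕ, geomCoeff x y q * (Real.exp (-η * t) *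
      (t ^ (d * q.1 + e * q.2 + c) / Real.Gamma (d * q.1 + e * q.2 + c + 1))) := by
      ext s
      rw [fracSeries, ← tsum_mul_left]
      exact tsum_congr fun q => by ring
    rw [h1]
    simp_rw [integral_const_mul, hlap] at hmain
    exact hmain.unique (hasSum_geomCoeff_mul_rpow x y d e (c + 1) hη' h)
  · have h2 : ∀ q : ℕ × ℕ, ∫ t in Ioi 0, ‖geomCoeff x y q * (Real.exp (-η * t) *
      (t ^ (d * q.1 + e * q.2 + c) / Real.Gamma (d * q.1 + e * q.2 + c + 1)))‖ =
      geomCoeff |x| |y| q * (1 / η) ^ (d * q.1 + e * q.2 + (c + 1)) := by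
      intro q
      rw [← hlap, ← integral_const_mul]
      refine setIntegral_congr_fun measurableSet_Ioi fun s hs => ?_
      have := hΓ q
      have h3 : 0 < s := hs
      rw [norm_mul, Real.norm_eq_abs, Real.norm_of_nonneg (by positivity), abs_geomCoeff]
    simp_rw [h2]
    exact (hasSum_geomCoeff_mul_rpow |x| |y| d e (c + 1) hη' (by simpa using h)).summable

lemma integrable_exp_mul_fracSeries (x y : ℝ) {d e c η : ℝ} (hd : 0 < d) (he : 0 < e)
    (hc : 0 ≤ c) (hη : 0 < η) (h : |x| * (1 / η) ^ d + |y| * (1 / η) ^ e < 1) :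
    IntegrableOn (fun t => Real.exp (-η * t) * fracSeries x y d e c t) (Ioi 0) := by
  apply Integrable.of_integral_ne_zero
  rw [integral_exp_mul_fracSeries x y hd he hc hη h]
  have hη' : 0 < 1 / η := one_div_pos.2 hη
  have h1 : 0 < (1 / η) ^ d := by positivity
  have h2 : 0 < (1 / η) ^ e := by positivity
  have h3 : x * (1 / η) ^ d ≤ |x| * (1 / η) ^ d := by gcongr; exact le_abs_self x
  have h4 : y * (1 / η) ^ e ≤ |y| * (1 / η) ^ e := by gcongr; exact le_abs_self y
  have h5 : 0 < 1 - x * (1 / η) ^ d - y * (1 / η) ^ e := by linarith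
  positivity

lemma prod_range_div_factorial (r j : ℕ) :
    (∏ i ∈ Finset.range j, ((r : ℝ) + 1 + i)) / (j.factorial : ℝ) = (j + r).choose r := by
  rw [div_eq_iff (by positivity)]
  have h := Nat.ascFactorial_eq_prod_range (r + 1) j
  have h2 := Nat.ascFactorial_eq_factorial_mul_choose r j
  have h3 : ∏ i ∈ Finset.range j, (r + 1 + i) = (j + r).choose r * j.factorial := by
    rw [← h, h2, mul_comm, add_comm r j, Nat.choose_symm_add]
  exact_mod_cast h3

lemma mul_tsum_gml_eq_fracSeries {x y d e t : ℝ} (hd : 0 < d) (he : 0 < e) (ht : 0 < t) :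
    t ^ e * ∑' r : ℕ, (x * t ^ d) ^ r * gml e (e + d * r + 1) ((r : ℝ) + 1) (y * t ^ e) =
      fracSeries x y d e e t := by
  rw [fracSeries, (summable_fracSeries x y hd he he.le ht).tsum_prod, ← tsum_mul_left]
  refine tsum_congr fun r => ?_
  rw [gml, ← tsum_mul_left, ← tsum_mul_left]
  refine tsum_congr fun j => ?_
  have h1 : e * (j : ℝ) + (e + d * r + 1) = d * r + e * j + e + 1 := by ring
  rw [h1, ← mul_div_assoc (geomCoeff x y (r, j)), geomCoeff_mul_rpow x y d e e ht (r, j),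
    geomCoeff, ← prod_range_div_factorial]
  have h2 := (Nat.factorial_pos j).ne'
  field_simp

theorem double_order_fractional_relaxation (ν₁ ν₂ n₁ n₂ lam : ℝ)
    (h1 : 0 < ν₁) (h12 : ν₁ < ν₂) (h2 : ν₂ < 1)
    (hn1 : 0 < n₁) (hn2 : 0 < n₂) (hsum : n₁ + n₂ = 1) (hlam : 0 < lam)
    (ψ : ℝ → ℝ) (hψ0 : ψ 0 = 1)
    (hψ : ∀ t > (0:ℝ), ψ t =
      1 - (lam * t ^ ν₂ / n₂) * ∑' r : ℕ,
        (-(n₁ * t ^ (ν₂ - ν₁) / n₂)) ^ r *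
          gml ν₂ (ν₂ + (ν₂ - ν₁) * r + 1) ((r:ℝ) + 1) (-(lam * t ^ ν₂ / n₂))) :
    (∀ t > (0:ℝ), n₁ * caputo ν₁ ψ t + n₂ * caputo ν₂ ψ t = -lam * ψ t) ∧
    ∃ η₀ : ℝ, 0 ≤ η₀ ∧ ∀ η > η₀,
      (∫ t in Set.Ioi (0:ℝ), Real.exp (-η * t) * ψ t) =
        (n₁ * η ^ ν₁ + n₂ * η ^ ν₂) / (η * (lam + n₁ * η ^ ν₁ + n₂ * η ^ ν₂)) := by
  have hd : 0 < ν₂ - ν₁ := by linarith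
  have he : 0 < ν₂ := by linarith
  have hS : ∀ t > (0 : ℝ), ψ t =
      1 - lam / n₂ * fracSeries (-(n₁ / n₂)) (-(lam / n₂)) (ν₂ - ν₁) ν₂ ν₂ t := by
    intro t ht
    rw [hψ t ht, ← mul_tsum_gml_eq_fracSeries hd he ht]
    have e1 : -(n₁ * t ^ (ν₂ - ν₁) / n₂) = -(n₁ / n₂) * t ^ (ν₂ - ν₁) := by ring
    have e2 : -(lam * t ^ ν₂ / n₂) = -(lam / n₂) * t ^ ν₂ := by ring
    rw [e1, e2]
    ring
  refine ⟨fun t ht => ?_, ?_⟩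
  · have hderiv : ∀ s > (0 : ℝ), deriv ψ s =
        -(lam / n₂) * fracSeries (-(n₁ / n₂)) (-(lam / n₂)) (ν₂ - ν₁) ν₂ (ν₂ - 1) s := by
      intro s hs
      have h := ((hasDerivAt_fracSeries (-(n₁ / n₂)) (-(lam / n₂)) hd he he hs).const_mul
        (lam / n₂)).const_sub 1
      rw [neg_mul, ← h.deriv]
      refine Filter.EventuallyEq.deriv_eq ?_
      filter_upwards [Ioi_mem_nhds hs] with u hu using hS u hu
    have hcap : ∀ ν, 0 < ν → ν ≤ ν₂ → caputo ν ψ t =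
        -(lam / n₂) * fracSeries (-(n₁ / n₂)) (-(lam / n₂)) (ν₂ - ν₁) ν₂ (ν₂ - ν) t := by
      intro ν hν hν2
      have hΓ := (Real.Gamma_pos_of_pos (show 0 < 1 - ν by linarith)).ne'
      have hI : ∫ s in (0 : ℝ)..t, (t - s) ^ (-ν) * deriv ψ s =
          ∫ s in (0 : ℝ)..t, -(lam / n₂) * ((t - s) ^ (-ν) *
            fracSeries (-(n₁ / n₂)) (-(lam / n₂)) (ν₂ - ν₁) ν₂ (ν₂ - 1) s) := by
        rw [intervalIntegral.integral_of_le ht.le, intervalIntegral.integral_of_le ht.le]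
        refine setIntegral_congr_fun measurableSet_Ioc fun s hs => ?_
        rw [hderiv s hs.1]
        ring
      rw [caputo, hI, intervalIntegral.integral_const_mul,
        integral_sub_rpow_mul_fracSeries _ _ hd he hν (by linarith) hν2 ht]
      field_simp
    rw [hcap ν₁ h1 h12.le, hcap ν₂ he le_rfl, sub_self, fracSeries_zero _ _ hd he ht, hS t ht]
    field_simp
    ring
  · obtain ⟨η₀, h0, hη₀⟩ :=
      exists_forall_gt_mul_rpow_add_lt_one (-(n₁ / n₂)) (-(lam / n₂)) hd he
    refine ⟨η₀, h0, fun η hη => ?_⟩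
    have hpos : 0 < η := h0.trans_lt hη
    have hsm := hη₀ η hη
    have hI : ∫ t in Ioi (0 : ℝ), Real.exp (-η * t) * ψ t =
        ∫ t in Ioi (0 : ℝ), (Real.exp (-η * t) - lam / n₂ * (Real.exp (-η * t) *
          fracSeries (-(n₁ / n₂)) (-(lam / n₂)) (ν₂ - ν₁) ν₂ ν₂ t)) := by
      refine setIntegral_congr_fun measurableSet_Ioi fun t ht => ?_
      rw [hS t ht]
      ring
    have hexp := integral_exp_mul_Ioi (show -η < 0 by linarith) 0
    rw [hI, integral_sub (integrableOn_exp_mul_Ioi (by linarith) 0)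
      ((integrable_exp_mul_fracSeries _ _ hd he he.le hpos hsm).const_mul _),
      integral_const_mul, integral_exp_mul_fracSeries _ _ hd he he.le hpos hsm, hexp]
    have hp1 : 0 < η ^ ν₁ := by positivity
    have hp2 : 0 < η ^ ν₂ := by positivity
    rw [Real.rpow_add_one (by positivity), Real.rpow_sub (by positivity)]
    simp only [Real.div_rpow zero_le_one hpos.le, Real.one_rpow]
    have hden : 1 - -(n₁ / n₂) * (1 / η ^ ν₂ / (1 / η ^ ν₁)) - -(lam / n₂) * (1 / η ^ ν₂) =
        (lam + n₁ * η ^ ν₁ + n₂ * η ^ ν₂) / (n₂ * η ^ ν₂) := by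
      field_simp
      ring
    rw [hden]
    have hD : lam + n₁ * η ^ ν₁ + n₂ * η ^ ν₂ ≠ 0 := by positivity
    simp
    field_simp
    ring
end

section
/- Let n₁, n₂ > 0. For every y > 0 and every η > 0, ∫_{n₂ y}^∞ e^{−η t} · (n₁ (t − n₂ y/2)/√π) · e^{−n₁² y²/(4(t − n₂ y))} · (t − n₂ y)^{−3/2} dt = (n₂ + n₁ η^{−1/2}) · e^{−(n₂ η + n₁ √η) y}; that is, the time-Laplace transform of the transition density q_{1/2,1}(y,t) of the random time process T_{1/2,1} governing the double-order (ν₁ = 1/2, ν₂ = 1) fractional relaxation equals (n₂ + n₁ η^{−1/2}) e^{−(n₂ η + n₁ √η) y}. -/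
open Real MeasureTheory Set

open Filter Topology

/-- A primitive of the Gaussian `exp (-w ^ 2)` with limits `±√π / 2` at `±∞`. -/
lemma exists_gaussian_primitive :
    ∃ G : ℝ → ℝ, (∀ z, HasDerivAt G (exp (-z ^ 2)) z) ∧
      Tendsto G atTop (𝓝 (√π / 2)) ∧ Tendsto G atBot (𝓝 (-(√π / 2))) := by
  have hc : Continuous fun w : ℝ => exp (-w ^ 2) := by fun_prop
  have htop : Tendsto (fun z => ∫ w in (0 : ℝ)..z, exp (-w ^ 2)) atTop (𝓝 (√π / 2)) := by
    have hi : Integrable fun w : ℝ => exp (-w ^ 2) := by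
      simpa using integrable_exp_neg_mul_sq one_pos
    have hv := integral_gaussian_Ioi 1
    simp only [div_one, neg_mul, one_mul] at hv
    rw [← hv]
    exact intervalIntegral_tendsto_integral_Ioi 0 hi.integrableOn tendsto_id
  refine ⟨fun z => ∫ w in (0 : ℝ)..z, exp (-w ^ 2), fun z => ?_, htop, ?_⟩
  · exact intervalIntegral.integral_hasDerivAt_right (hc.intervalIntegrable _ _)
      hc.stronglyMeasurable.stronglyMeasurableAtFilter hc.continuousAt
  · refine (htop.comp tendsto_neg_atBot_atTop).neg.congr fun z => ?_
    have h := intervalIntegral.integral_comp_neg (a := 0) (b := z) fun w : ℝ => exp (-w ^ 2)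
    simp only [even_two.neg_pow, neg_zero] at h
    simp only [Function.comp_apply]
    rw [intervalIntegral.integral_symm, neg_neg, h]

/-- Laplace-type integrals `∫ s ^ (-1/2) exp (-c² s - b² / s)` and
`∫ s ^ (-3/2) exp (-c² s - b² / s)`, in a nonnegative combination. -/
lemma integral_exp_neg_add_inv {b c p q : ℝ} (hb : 0 < b) (hc : 0 < c) (hp : 0 ≤ p)
    (hq : 0 ≤ q) :
    ∫ s in Ioi (0 : ℝ), exp (-(c ^ 2 * s + b ^ 2 / s)) * (p / √s + q / (s * √s)) =
      √π * exp (-(2 * b * c)) * (p / c + q / b) := by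
  obtain ⟨G, hG, hGtop, hGbot⟩ := exists_gaussian_primitive
  set A := p / c + q / b with hA
  set B := p / c - q / b with hB
  set F : ℝ → ℝ := fun s => exp (-(2 * b * c)) * A * G (c * √s - b * (√s)⁻¹) +
    exp (2 * b * c) * B * G (c * √s + b * (√s)⁻¹)
  set m := exp (-(2 * b * c)) * A * (-(√π / 2)) + exp (2 * b * c) * B * (√π / 2) with hm
  have hsqrt : Tendsto (fun s : ℝ => √s) atTop atTop := Real.tendsto_sqrt_atTop
  have hctop : Tendsto (fun s : ℝ => c * √s) atTop atTop := hsqrt.const_mul_atTop hc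
  have hinv : Tendsto (fun s : ℝ => b * (√s)⁻¹) atTop (𝓝 0) := by
    simpa using (tendsto_inv_atTop_zero.comp hsqrt).const_mul b
  have hsqrt0 : Tendsto (fun s : ℝ => √s) (𝓝[>] 0) (𝓝[>] 0) := by
    refine tendsto_nhdsWithin_iff.2 ⟨?_, ?_⟩
    · simpa using (continuous_sqrt.tendsto 0).mono_left (nhdsWithin_le_nhds (s := Ioi 0))
    · filter_upwards [self_mem_nhdsWithin] with s hs using sqrt_pos.2 hs
  have hc0 : Tendsto (fun s : ℝ => c * √s) (𝓝[>] 0) (𝓝 0) := by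
    simpa using (hsqrt0.mono_right nhdsWithin_le_nhds).const_mul c
  have hinv0 : Tendsto (fun s : ℝ => b * (√s)⁻¹) (𝓝[>] 0) atTop :=
    (tendsto_inv_nhdsGT_zero.comp hsqrt0).const_mul_atTop hb
  have hF0 : Tendsto F (𝓝[>] 0) (𝓝 m) := by
    refine ((hGbot.comp ?_).const_mul _).add ((hGtop.comp ?_).const_mul _)
    · simpa only [sub_eq_add_neg, Function.comp_def] using
        hc0.add_atBot (tendsto_neg_atTop_atBot.comp hinv0)
    · exact hc0.add_atTop hinv0
  have hFtop : Tendsto F atTop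
      (𝓝 (exp (-(2 * b * c)) * A * (√π / 2) + exp (2 * b * c) * B * (√π / 2))) := by
    refine ((hGtop.comp ?_).const_mul _).add ((hGtop.comp ?_).const_mul _)
    · simpa only [sub_eq_add_neg] using hctop.atTop_add hinv.neg
    · exact hctop.atTop_add hinv
  have hderiv : ∀ s ∈ Ioi (0 : ℝ), HasDerivAt F
      (exp (-(c ^ 2 * s + b ^ 2 / s)) * (p / √s + q / (s * √s))) s := by
    intro s (hs : 0 < s)
    have hr : 0 < √s := sqrt_pos.2 hs
    have hrs : √s ^ 2 = s := sq_sqrt hs.le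
    have h1 := hasDerivAt_sqrt hs.ne'
    have h2 := h1.inv hr.ne'
    have h3 := (((hG _).comp s ((h1.const_mul c).sub (h2.const_mul b))).const_mul
      (exp (-(2 * b * c)) * A)).add
      (((hG _).comp s ((h1.const_mul c).add (h2.const_mul b))).const_mul (exp (2 * b * c) * B))
    refine h3.congr_deriv ?_
    have e1 : exp (-(2 * b * c)) * exp (-(c * √s - b * (√s)⁻¹) ^ 2) =
        exp (-(c ^ 2 * s + b ^ 2 / s)) := by
      rw [← exp_add]
      congr 1
      nth_rewrite 3 4 [← hrs]
      field_simp
      ring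
    have e2 : exp (2 * b * c) * exp (-(c * √s + b * (√s)⁻¹) ^ 2) =
        exp (-(c ^ 2 * s + b ^ 2 / s)) := by
      rw [← exp_add]
      congr 1
      nth_rewrite 3 4 [← hrs]
      field_simp
      ring
    simp only [Pi.sub_apply, Pi.add_apply, Pi.inv_apply]
    trans exp (-(2 * b * c)) * exp (-(c * √s - b * (√s)⁻¹) ^ 2) * A *
        (c * (1 / (2 * √s)) - b * (-(1 / (2 * √s)) / √s ^ 2)) +
      exp (2 * b * c) * exp (-(c * √s + b * (√s)⁻¹) ^ 2) * B *
        (c * (1 / (2 * √s)) + b * (-(1 / (2 * √s)) / √s ^ 2))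
    · ring
    rw [e1, e2, hrs, hA, hB]
    field_simp
    ring
  classical
  have key := integral_Ioi_of_hasDerivAt_of_nonneg (a := 0) (g := Function.update F 0 m)
    (continuousWithinAt_update_same.2 (by rwa [Ici_sdiff_left]))
    (fun s hs => (hderiv s hs).congr_of_eventuallyEq <| by
      filter_upwards [Ioi_mem_nhds hs] with x hx
      exact Function.update_of_ne (ne_of_gt hx) _ _)
    (fun s (hs : 0 < s) => by positivity)
    (hFtop.congr' <| by
      filter_upwards [Ioi_mem_atTop (0 : ℝ)] with x hx
      exact (Function.update_of_ne (ne_of_gt hx) _ _).symm)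
  rw [key, Function.update_self, hm]
  ring

theorem double_order_random_time_laplace (n₁ n₂ : ℝ) (hn1 : 0 < n₁) (hn2 : 0 < n₂) :
    ∀ y > (0:ℝ), ∀ η > (0:ℝ),
      (∫ t in Set.Ioi (n₂ * y),
          Real.exp (-η * t) * (n₁ * (t - n₂ * y / 2) / Real.sqrt Real.pi) *
            Real.exp (-(n₁ ^ 2 * y ^ 2) / (4 * (t - n₂ * y))) *
            (t - n₂ * y) ^ (-(3:ℝ)/2)) =
        (n₂ + n₁ * (Real.sqrt η)⁻¹) * Real.exp (-(n₂ * η + n₁ * Real.sqrt η) * y) := by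
  intro y hy η hη
  have hshift := (measurePreserving_add_right volume (n₂ * y)).setIntegral_preimage_emb
    (measurableEmbedding_addRight (n₂ * y)) (fun t => Real.exp (-η * t) *
      (n₁ * (t - n₂ * y / 2) / Real.sqrt Real.pi) *
      Real.exp (-(n₁ ^ 2 * y ^ 2) / (4 * (t - n₂ * y))) * (t - n₂ * y) ^ (-(3:ℝ)/2))
    (Ioi (n₂ * y))
  rw [← hshift, preimage_add_const_Ioi, sub_self]
  have hsη : 0 < √η := sqrt_pos.2 hη
  have hπ : 0 < √π := sqrt_pos.2 pi_pos
  have key := integral_exp_neg_add_inv (b := n₁ * y / 2) (c := √η) (p := n₁)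
    (q := n₁ * (n₂ * y / 2)) (by positivity) hsη hn1.le (by positivity)
  trans ∫ s in Ioi (0 : ℝ), exp (-η * (n₂ * y)) / √π *
      (exp (-(√η ^ 2 * s + (n₁ * y / 2) ^ 2 / s)) *
        (n₁ / √s + n₁ * (n₂ * y / 2) / (s * √s)))
  · refine setIntegral_congr_fun measurableSet_Ioi fun s (hs : 0 < s) => ?_
    have hr : 0 < √s := sqrt_pos.2 hs
    have hpow : s ^ (-(3 : ℝ) / 2) = (s * √s)⁻¹ := by
      rw [neg_div, rpow_neg hs.le, show (3 : ℝ) / 2 = 1 + 1 / 2 by norm_num, rpow_add hs,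
        rpow_one, ← sqrt_eq_rpow]
    have hexp : exp (-η * (s + n₂ * y)) * exp (-(n₁ ^ 2 * y ^ 2) / (4 * s)) =
        exp (-η * (n₂ * y)) * exp (-(√η ^ 2 * s + (n₁ * y / 2) ^ 2 / s)) := by
      rw [← exp_add, ← exp_add, sq_sqrt hη.le]
      congr 1
      field_simp
      ring
    simp only [add_sub_cancel_right]
    rw [hpow]
    trans exp (-η * (s + n₂ * y)) * exp (-(n₁ ^ 2 * y ^ 2) / (4 * s)) *
      (n₁ * (s + n₂ * y - n₂ * y / 2) / √π * (s * √s)⁻¹)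
    · ring
    rw [hexp]
    field_simp
    ring
  · rw [integral_const_mul, key,
      show -(n₂ * η + n₁ * √η) * y = -η * (n₂ * y) + -(2 * (n₁ * y / 2) * √η) by ring, exp_add]
    field_simp
    ring
end
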